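/- arXiv:1710.00907 — 4 statements merged into one kernel-verified Lean document; each statement's English description precedes it below -/
import Mathlib

section
/- Let R be a Cohen-Macaulay complete Noetherian local ring with maximal ideal m, and let M and N be finitely generated maximal Cohen-Macaulay R-modules which are locally free at every nonmaximal prime ideal (M_𝔭 and N_𝔭 are free R_𝔭-modules for every nonmaximal prime 𝔭), both indecomposable, and with M not isomorphic to N. Let x ∈ m be a nonzerodivisor on R. Then there exists i ≥ 1 such that M/x^iM and N/x^iN are both indecomposable R-modules and M/x^iM is not isomorphic to N/x^iN. -/
universe u

/-- The depth of a module `M` over a Noetherian local ring `R`: the supremum of the lengths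
of `M`-regular sequences consisting of elements of the maximal ideal. -/
noncomputable def moduleDepth (R : Type*) [CommRing R] [IsLocalRing R]
    (M : Type*) [AddCommGroup M] [Module R M] : ℕ∞ :=
  ⨆ (rs : List R) (_ : RingTheory.Sequence.IsRegular M rs)
    (_ : ∀ r ∈ rs, r ∈ IsLocalRing.maximalIdeal R), (rs.length : ℕ∞)

/-- A module is indecomposable if it is nonzero and is not the (internal) direct sum of two
nonzero submodules. -/
def IsIndecomposableModule (R : Type*) [CommRing R] (M : Type*) [AddCommGroup M]
    [Module R M] : Prop :=
  Nontrivial M ∧ ¬∃ (N₁ N₂ : Submodule R M), IsCompl N₁ N₂ ∧ N₁ ≠ ⊥ ∧ N₂ ≠ ⊥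

open IsLocalRing
open scoped Pointwise

section Depth

variable {R : Type*} [CommRing R] [IsNoetherianRing R] [IsLocalRing R]

/-- If `r ∈ 𝔪` is regular on `M`, then every associated prime of `M` is strictly contained in an
associated prime of `M / rM`. -/
theorem exists_isAssociatedPrime_quotSMulTop_gt {M : Type*} [AddCommGroup M] [Module R M]
    [Module.Finite R M] {r : R} (hr : r ∈ maximalIdeal R) (hreg : IsSMulRegular M r)
    {p : Ideal R} (hp : IsAssociatedPrime p M) :
    ∃ q : Ideal R, IsAssociatedPrime q (QuotSMulTop r M) ∧ p < q := by
  obtain ⟨hprime, y, hy⟩ := isAssociatedPrime_iff.mp hp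
  have hrp : r ∉ p := by
    intro h
    rw [hy, Submodule.mem_colon_singleton, Submodule.mem_bot] at h
    have hy0 : y = 0 := hreg (by simpa using h)
    exact hprime.ne_top (by simp [hy, hy0])
  let U : Submodule R M := Submodule.torsionBySet R M p
  have hyU : y ∈ U := by
    rw [Submodule.mem_torsionBySet_iff]
    rintro ⟨a, ha⟩
    rw [SetLike.mem_coe, hy, Submodule.mem_colon_singleton, Submodule.mem_bot] at ha
    exact ha
  have hU : ∃ z ∈ U, z ∉ r • (⊤ : Submodule R M) := by
    by_contra! hcon
    have hUbot : U = ⊥ := by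
      refine Submodule.eq_bot_of_le_smul_of_le_jacobson_bot (Ideal.span {r}) U
        (IsNoetherian.noetherian U) ?_
        (((Ideal.span_singleton_le_iff_mem _).mpr hr).trans (maximalIdeal_le_jacobson _))
      intro z hz
      obtain ⟨w, -, rfl⟩ := (Submodule.mem_smul_pointwise_iff_exists _ _ _).mp (hcon z hz)
      rw [Submodule.ideal_span_singleton_smul]
      refine Submodule.smul_mem_pointwise_smul _ _ _ ?_
      rw [Submodule.mem_torsionBySet_iff] at hz ⊢
      intro a
      refine hreg ?_
      simpa [smul_comm r] using hz a
    have hy0 : y = 0 := by simpa [hUbot] using hyU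
    exact hprime.ne_top (by simp [hy, hy0])
  obtain ⟨z, hzU, hz⟩ := hU
  obtain ⟨q, hq, hle⟩ := exists_le_isAssociatedPrime_of_isNoetherianRing R
    (Submodule.Quotient.mk z : QuotSMulTop r M)
    (by rwa [ne_eq, Submodule.Quotient.mk_eq_zero])
  refine ⟨q, hq, lt_of_le_of_ne (fun a ha ↦ hle ?_) fun h ↦ hrp (h ▸ hle ?_)⟩
  · rw [Submodule.mem_colon_singleton, Submodule.mem_bot, ← Submodule.Quotient.mk_smul]
    rw [Submodule.mem_torsionBySet_iff] at hzU
    rw [hzU ⟨a, ha⟩, Submodule.Quotient.mk_zero]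
  · rw [Submodule.mem_colon_singleton, Submodule.mem_bot, ← Submodule.Quotient.mk_smul,
      Submodule.Quotient.mk_eq_zero]
    exact Submodule.smul_mem_pointwise_smul _ _ _ trivial

theorem length_le_coheight_of_isRegular (rs : List R) (hrs : ∀ r ∈ rs, r ∈ maximalIdeal R)
    {M : Type*} [AddCommGroup M] [Module R M] [Module.Finite R M]
    (hreg : RingTheory.Sequence.IsRegular M rs)
    (p : PrimeSpectrum R) (hp : IsAssociatedPrime p.asIdeal M) :
    (rs.length : ℕ∞) ≤ Order.coheight p := by
  induction rs generalizing M p with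
  | nil => simp
  | cons r rs ih =>
    obtain ⟨h1, h2⟩ := (RingTheory.Sequence.isRegular_cons_iff M r rs).mp hreg
    obtain ⟨q, hq, hlt⟩ := exists_isAssociatedPrime_quotSMulTop_gt
      (hrs r (List.mem_cons_self ..)) h1 hp
    have hlt' : p < (⟨q, hq.isPrime⟩ : PrimeSpectrum R) := hlt
    have := ih (fun s hs ↦ hrs s (List.mem_cons_of_mem _ hs)) h2 ⟨q, hq.isPrime⟩ hq
    rw [List.length_cons, Nat.cast_add, Nat.cast_one]
    exact (add_le_add_left this 1).trans (Order.coheight_add_one_le hlt')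

/-- Depth is bounded by the dimension of `R / p` for every associated prime `p`. -/
theorem moduleDepth_le_coheight {M : Type*} [AddCommGroup M] [Module R M] [Module.Finite R M]
    (p : PrimeSpectrum R) (hp : IsAssociatedPrime p.asIdeal M) :
    moduleDepth R M ≤ Order.coheight p :=
  iSup_le fun rs ↦ iSup_le fun hreg ↦ iSup_le fun hrs ↦
    length_le_coheight_of_isRegular rs hrs hreg p hp

/-- A nonzerodivisor of `R` is regular on every maximal Cohen-Macaulay module. -/
theorem isSMulRegular_of_moduleDepth_eq {M : Type*} [AddCommGroup M] [Module R M]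
    [Module.Finite R M] (hM : (moduleDepth R M : WithBot ℕ∞) = ringKrullDim R)
    {x : R} (hx : x ∈ nonZeroDivisors R) : IsSMulRegular M x := by
  rw [isSMulRegular_iff_right_eq_zero_of_smul]
  intro y hxy
  by_contra hy
  obtain ⟨p, hp, hle⟩ := exists_le_isAssociatedPrime_of_isNoetherianRing R y hy
  have hxp : x ∈ p := hle (by simpa [Submodule.mem_colon_singleton] using hxy)
  have hprime := hp.isPrime
  let P : PrimeSpectrum R := ⟨p, hprime⟩
  have hdepth : moduleDepth R M ≤ Order.coheight P := moduleDepth_le_coheight P hp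
  have hmin : IsMin P := by
    rw [isMin_iff_forall_not_lt]
    intro Q hQ
    have h1 : Order.coheight P + 1 ≤ Order.coheight Q := Order.coheight_add_one_le hQ
    have h2 : (Order.coheight Q : WithBot ℕ∞) ≤ moduleDepth R M :=
      hM ▸ Order.coheight_le_krullDim Q
    have h3 : Order.coheight P + 1 ≤ Order.coheight P :=
      h1.trans ((WithBot.coe_le_coe.mp h2).trans hdepth)
    have h4 : Order.coheight P ≠ ⊤ := (Order.coheight_lt_top P).ne
    exact (ENat.lt_add_one_iff h4).mpr le_rfl |>.not_ge h3
  have : p ∈ minimalPrimes R := by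
    rw [minimalPrimes_eq_minimals]
    exact ⟨hprime, fun q hq hle ↦ hmin (b := ⟨q, hq⟩) hle⟩
  exact notMem_nonZeroDivisors_of_mem_mem_minimalPrimes hxp this hx

end Depth

section Complete

theorem IsPrecomplete.of_finite {R : Type*} [CommRing R] (I : Ideal R) [IsPrecomplete I R]
    (M : Type*) [AddCommGroup M] [Module R M] [Module.Finite R M] : IsPrecomplete I M := by
  rw [← AdicCompletion.of_surjective_iff]
  intro y
  obtain ⟨t, rfl⟩ := AdicCompletion.ofTensorProduct_surjective_of_finite I M y
  induction t with
  | zero => exact ⟨0, by simp⟩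
  | add a b ha hb =>
    obtain ⟨u, hu⟩ := ha
    obtain ⟨v, hv⟩ := hb
    exact ⟨u + v, by simp [hu, hv]⟩
  | tmul r m =>
    obtain ⟨s, rfl⟩ := AdicCompletion.of_surjective I R r
    refine ⟨s • m, ?_⟩
    rw [AdicCompletion.ofTensorProduct_tmul]
    ext n
    rw [AdicCompletion.smul_eval, map_smul, AdicCompletion.val_smul_apply]
    rfl

theorem IsAdicComplete.of_finite {R : Type*} [CommRing R] [IsNoetherianRing R] (I : Ideal R)
    [IsAdicComplete I R] (M : Type*) [AddCommGroup M] [Module R M] [Module.Finite R M] :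
    IsAdicComplete I M where
  toIsHausdorff := IsHausdorff.of_le_jacobson I M (IsAdicComplete.le_jacobson_bot I)
  toIsPrecomplete := IsPrecomplete.of_finite I M

/-- Idempotents lift modulo `I` in a commutative finite algebra over a complete ring. -/
theorem exists_isIdempotentElem_sub_mem_map {R A : Type*} [CommRing R] [IsNoetherianRing R]
    (I : Ideal R) [IsAdicComplete I R] [CommRing A] [Algebra R A] [Module.Finite R A] (g : A)
    (hg : g ^ 2 - g ∈ I.map (algebraMap R A)) :
    ∃ e : A, IsIdempotentElem e ∧ e - g ∈ I.map (algebraMap R A) := by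
  have hc : IsAdicComplete I A := IsAdicComplete.of_finite I A
  have : IsAdicComplete (I.map (algebraMap R A)) A :=
    { toIsHausdorff := IsHausdorff.map_algebraMap_iff.mpr inferInstance
      toIsPrecomplete := IsPrecomplete.map_algebraMap_iff.mpr inferInstance }
  obtain ⟨e, he, heg⟩ := HenselianRing.is_henselian (I := I.map (algebraMap R A))
    (Polynomial.X ^ 2 - Polynomial.X : Polynomial A)
    (Polynomial.monic_X_pow_sub (n := 2) (by
      simpa using Polynomial.degree_X_le.trans_lt (by decide)))
    g (by simpa using hg) (by
      refine IsUnit.of_mul_eq_one (Ideal.Quotient.mk _ (2 * g - 1)) ?_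
      rw [← map_mul, ← map_one (Ideal.Quotient.mk (I.map (algebraMap R A))), Ideal.Quotient.eq]
      have : Polynomial.eval g (Polynomial.derivative (Polynomial.X ^ 2 - Polynomial.X)) *
          (2 * g - 1) - 1 = 4 * (g ^ 2 - g) := by simp; ring
      rw [this]
      exact Ideal.mul_mem_left _ _ hg)
  refine ⟨e, ?_, heg⟩
  have : e ^ 2 - e = 0 := by simpa using he
  rw [IsIdempotentElem, ← pow_two]
  exact sub_eq_zero.mp this

end Complete

section Indecomposable

variable {R : Type*} [CommRing R] {M : Type*} [AddCommGroup M] [Module R M]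

theorem isIndecomposableModule_iff_isIdempotentElem [Nontrivial M] :
    IsIndecomposableModule R M ↔
      ∀ e : Module.End R M, IsIdempotentElem e → e = 0 ∨ e = 1 := by
  constructor
  · rintro ⟨-, h⟩ e he
    by_contra! hcon
    refine h ⟨_, _, LinearMap.IsIdempotentElem.isCompl he, ?_, ?_⟩
    · rw [ne_eq, LinearMap.range_eq_bot]
      exact hcon.1
    · intro hker
      refine hcon.2 (LinearMap.ext fun m ↦ LinearMap.ker_eq_bot.mp hker ?_)
      exact LinearMap.congr_fun he m
  · refine fun h ↦ ⟨inferInstance, ?_⟩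
    rintro ⟨N₁, N₂, hc, h₁, h₂⟩
    rcases h _ (Submodule.isIdempotentElem_projection hc) with h0 | h0
    · exact h₁ (by rw [← Submodule.range_projection hc, h0, LinearMap.range_zero])
    · exact h₂ (by rw [← Submodule.ker_projection hc, h0]; exact LinearMap.ker_id)

instance Module.Finite.linearMap_of_isNoetherianRing [IsNoetherianRing R] [Module.Finite R M]
    {N : Type*} [AddCommGroup N] [Module R N] [Module.Finite R N] :
    Module.Finite R (M →ₗ[R] N) := by
  obtain ⟨n, p, hp⟩ := Module.Finite.exists_fin' R M
  exact Module.Finite.of_injective (LinearMap.lcomp R N p)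
    fun f g h ↦ (LinearMap.cancel_right hp).mp h

/-- Over a complete local ring, an endomorphism of an indecomposable module which is idempotent
modulo a regular element is trivial modulo the maximal ideal. -/
theorem IsIndecomposableModule.apply_mem_smul_top [IsNoetherianRing R] (I : Ideal R)
    [IsAdicComplete I R] [Module.Finite R M] (hM : IsIndecomposableModule R M)
    {y : R} (hy : y ∈ I) (hreg : IsSMulRegular M y)
    {g u : Module.End R M} (hgu : g ^ 2 - g = y • u) :
    (∀ m, g m ∈ I • (⊤ : Submodule R M)) ∨ ∀ m, m - g m ∈ I • (⊤ : Submodule R M) := by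
  have : Nontrivial M := hM.1
  have hcomm : g * u = u * g := by
    ext m
    refine hreg ?_
    have h : y • (g * u) = y • (u * g) := by
      rw [← mul_smul_comm, ← smul_mul_assoc, ← hgu]
      noncomm_ring
    exact LinearMap.congr_fun h m
  let A := Algebra.adjoin R {g, u}
  have hA : IsMulCommutative A := Algebra.isMulCommutative_adjoin R (by
    rintro a (rfl | rfl) b (rfl | rfl)
    exacts [rfl, hcomm, hcomm.symm, rfl])
  let _ : CommRing A := { (inferInstance : Ring A) with mul_comm := hA.is_comm.comm }
  have : Module.Finite R A := Module.Finite.of_injective A.val.toLinearMap Subtype.val_injective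
  let gA : A := ⟨g, Algebra.subset_adjoin (by simp)⟩
  let uA : A := ⟨u, Algebra.subset_adjoin (by simp)⟩
  have hgA : gA ^ 2 - gA ∈ I.map (algebraMap R A) := by
    have : gA ^ 2 - gA = algebraMap R A y * uA := by
      rw [← Algebra.smul_def]
      exact Subtype.ext hgu
    rw [this]
    exact Ideal.mul_mem_right _ _ (Ideal.mem_map_of_mem _ hy)
  obtain ⟨e, he, heg⟩ := exists_isIdempotentElem_sub_mem_map I gA hgA
  have hmem : ∀ a ∈ I.map (algebraMap R A), ∀ m,
      (a : Module.End R M) m ∈ I • (⊤ : Submodule R M) := by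
    intro a ha m
    induction ha using Submodule.span_induction with
    | mem a ha =>
      obtain ⟨r, hr, rfl⟩ := ha
      exact Submodule.smul_mem_smul hr trivial
    | zero => exact zero_mem _
    | add a b _ _ ha hb => exact add_mem ha hb
    | smul c a _ ha =>
      have : ((c • a : A) : Module.End R M) = c * a := rfl
      rw [this, Module.End.mul_apply]
      have h := Submodule.mem_map_of_mem (f := (c : Module.End R M)) ha
      rw [Submodule.map_smul''] at h
      exact Submodule.smul_mono le_rfl le_top h
  have hsub : ∀ m, (e : Module.End R M) m - g m ∈ I • (⊤ : Submodule R M) := hmem _ heg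
  rcases isIndecomposableModule_iff_isIdempotentElem.mp hM (e : Module.End R M)
    (congrArg Subtype.val he) with h | h
  · exact .inl fun m ↦ by simpa [h] using hsub m
  · exact .inr fun m ↦ by simpa [h] using hsub m

end Indecomposable

section Lifting

variable {R : Type*} [CommRing R] {M N : Type*} [AddCommGroup M] [Module R M]
  [AddCommGroup N] [Module R N]

theorem LinearMap.exists_eq_smul_of_isSMulRegular {r : R} (hr : IsSMulRegular N r) (h : M →ₗ[R] N)
    (hh : ∀ m, ∃ n, h m = r • n) : ∃ g : M →ₗ[R] N, h = r • g := by
  choose g hg using hh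
  refine ⟨{ toFun := g, map_add' := fun a b ↦ hr ?_, map_smul' := fun c a ↦ hr ?_ },
    LinearMap.ext hg⟩
  · simp [← hg]
  · simp [← hg, smul_comm r c]

theorem mem_span_singleton_smul_top {r : R} {m : M} :
    m ∈ Ideal.span {r} • (⊤ : Submodule R M) ↔ ∃ n, m = r • n := by
  rw [Submodule.ideal_span_singleton_smul, Submodule.mem_smul_pointwise_iff_exists]
  simp [eq_comm]

/-- If multiplication by `x ^ k` on `M` factors through a projective module, then homomorphisms
`M / x ^ i M → N / x ^ i N` lift to `M → N` up to a multiple of `x ^ (i - k)`. -/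
theorem exists_lift_modulo_pow {x : R} (hx : IsSMulRegular N x) {k i : ℕ} (hki : k ≤ i)
    {F : Type*} [AddCommGroup F] [Module R F] [Module.Projective R F]
    {a : M →ₗ[R] F} {p : F →ₗ[R] M} (hpa : ∀ m, p (a m) = x ^ k • m)
    (f : (M ⧸ (Ideal.span {x ^ i} • (⊤ : Submodule R M))) →ₗ[R]
      (N ⧸ (Ideal.span {x ^ i} • (⊤ : Submodule R N)))) :
    ∃ g : M →ₗ[R] N, ∀ m, ∃ n,
      f (Submodule.Quotient.mk m) = Submodule.Quotient.mk (g m + x ^ (i - k) • n) := by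
  obtain ⟨h, hh⟩ := Module.projective_lifting_property
    (Ideal.span {x ^ i} • (⊤ : Submodule R N)).mkQ
    (f ∘ₗ (Ideal.span {x ^ i} • (⊤ : Submodule R M)).mkQ ∘ₗ p) (Submodule.mkQ_surjective _)
  have key : ∀ m, ∃ n₀ n₁, f (Submodule.Quotient.mk m) = Submodule.Quotient.mk n₀ ∧
      h (a m) = x ^ k • (n₀ + x ^ (i - k) • n₁) := by
    intro m
    obtain ⟨n₀, hn₀⟩ := Submodule.Quotient.mk_surjective _ (f (Submodule.Quotient.mk m))
    have h1 : (Submodule.Quotient.mk (h (a m)) : N ⧸ (Ideal.span {x ^ i} • (⊤ : Submodule R N))) =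
        Submodule.Quotient.mk (x ^ k • n₀) := by
      have := LinearMap.congr_fun hh (a m)
      simp only [LinearMap.comp_apply, Submodule.mkQ_apply, hpa] at this
      rw [this, Submodule.Quotient.mk_smul, map_smul, Submodule.Quotient.mk_smul, hn₀]
    obtain ⟨n₁, hn₁⟩ := mem_span_singleton_smul_top.mp ((Submodule.Quotient.eq _).mp h1)
    refine ⟨n₀, n₁, hn₀.symm, ?_⟩
    rw [smul_add, smul_smul, ← pow_add, Nat.add_sub_cancel' hki, ← hn₁]
    abel
  obtain ⟨g, hg⟩ := LinearMap.exists_eq_smul_of_isSMulRegular (hx.pow k) (h ∘ₗ a) fun m ↦ by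
    obtain ⟨n₀, n₁, -, h2⟩ := key m
    exact ⟨_, h2⟩
  refine ⟨g, fun m ↦ ?_⟩
  obtain ⟨n₀, n₁, h1, h2⟩ := key m
  refine ⟨-n₁, ?_⟩
  have h3 : g m = n₀ + x ^ (i - k) • n₁ := hx.pow k (by
    simpa [h2] using (LinearMap.congr_fun hg m).symm)
  rw [h1, h3]
  simp

end Lifting

section LocallyFree

/-- If `M` is locally free away from the maximal ideal, then multiplication on `M` by some power of
any `x ∈ 𝔪` factors through a finite free module. -/
theorem exists_pow_smul_factors_through_free {R : Type*} [CommRing R] [IsNoetherianRing R]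
    [IsLocalRing R] {M : Type*} [AddCommGroup M] [Module R M] [Module.Finite R M]
    (hM : ∀ (q : Ideal R) (_ : q.IsPrime), q ≠ maximalIdeal R →
      Module.Free (Localization.AtPrime q) (LocalizedModule q.primeCompl M))
    {x : R} (hx : x ∈ maximalIdeal R) :
    ∃ (k n : ℕ) (a : M →ₗ[R] (Fin n → R)) (p : (Fin n → R) →ₗ[R] M),
      ∀ m, p (a m) = x ^ k • m := by
  obtain ⟨n, p, hp⟩ := Module.Finite.exists_fin' R M
  let J : Ideal R := Submodule.comap (LinearMap.toSpanSingleton R (M →ₗ[R] M) LinearMap.id)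
    (LinearMap.range (p.compRight R (M := M)))
  have hJ : ∀ {r}, r ∈ J ↔ ∃ a : M →ₗ[R] (Fin n → R), p ∘ₗ a = r • LinearMap.id := by
    intro r; rfl
  suffices hxJ : x ∈ J.radical by
    obtain ⟨k, hk⟩ := hxJ
    obtain ⟨a, ha⟩ := hJ.mp hk
    exact ⟨k, n, a, p, fun m ↦ LinearMap.congr_fun ha m⟩
  rw [Ideal.radical_eq_sInf, Ideal.mem_sInf]
  rintro q ⟨hJq, hq⟩
  by_cases hqm : q = maximalIdeal R
  · rwa [hqm]
  exfalso
  have := hM q hq hqm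
  let S := q.primeCompl
  let fM := LocalizedModule.mkLinearMap S M
  let fF := LocalizedModule.mkLinearMap S (Fin n → R)
  have hps : Function.Surjective (LocalizedModule.map S p) := LocalizedModule.map_surjective S p hp
  obtain ⟨σ, hσ⟩ := Module.projective_lifting_property (LocalizedModule.map S p) LinearMap.id hps
  have : Module.FinitePresentation R M := Module.finitePresentation_of_finite R M
  obtain ⟨h, s, hs⟩ := Module.FinitePresentation.exists_lift_of_isLocalizedModule S fF
    ((σ.restrictScalars R) ∘ₗ fM)
  have hcomp : fM ∘ₗ (p ∘ₗ h) = fM ∘ₗ (s.1 • LinearMap.id) := by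
    ext m
    have h1 : fM (p (h m)) = LocalizedModule.map S p (fF (h m)) := by
      simp [fM, fF, LocalizedModule.map_mk]
    have h2 : fF (h m) = s.1 • σ (fM m) := LinearMap.congr_fun hs m
    have h3 : LocalizedModule.map S p (σ (fM m)) = fM m := LinearMap.congr_fun hσ (fM m)
    have h4 : LocalizedModule.map S p (s.1 • σ (fM m)) =
        s.1 • LocalizedModule.map S p (σ (fM m)) :=
      map_smul ((LocalizedModule.map S p).restrictScalars R) s.1 _
    simp only [LinearMap.comp_apply, h1, h2, h4, h3, LinearMap.smul_apply, LinearMap.id_apply,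
      map_smul]
  obtain ⟨t, ht⟩ := Module.Finite.exists_smul_of_comp_eq_of_isLocalizedModule S fM _ _ hcomp
  have hmem : t.1 * s.1 ∈ J := hJ.mpr ⟨t.1 • h, by
    rw [LinearMap.comp_smul, mul_smul]
    exact ht⟩
  exact (t * s).2 (hJq hmem)

end LocallyFree

section Maranda

variable {R : Type*} [CommRing R] [IsLocalRing R] {M N : Type*} [AddCommGroup M] [Module R M]
  [AddCommGroup N] [Module R N] {x : R}

theorem pow_smul_mem_maximalIdeal_smul_top (hx : x ∈ maximalIdeal R) {j : ℕ} (hj : j ≠ 0) (m : M) :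
    x ^ j • m ∈ maximalIdeal R • (⊤ : Submodule R M) :=
  Submodule.smul_mem_smul (Ideal.pow_mem_of_mem _ hx j (Nat.pos_of_ne_zero hj)) trivial

theorem nontrivial_quotient_span_pow_smul_top [Module.Finite R M] [Nontrivial M]
    (hx : x ∈ maximalIdeal R) {i : ℕ} (hi : i ≠ 0) :
    Nontrivial (M ⧸ (Ideal.span {x ^ i} • (⊤ : Submodule R M))) := by
  rw [Submodule.Quotient.nontrivial_iff]
  refine (Submodule.top_ne_ideal_smul_of_le_jacobson_annihilator ?_).symm
  exact ((Ideal.span_singleton_le_iff_mem _).mpr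
    (Ideal.pow_mem_of_mem _ hx i (Nat.pos_of_ne_zero hi))).trans (maximalIdeal_le_jacobson _)

/-- A linear map which becomes surjective on `M / x ^ i M → N / x ^ i N` up to a multiple of a
positive power of `x` is surjective. -/
theorem surjective_of_lift_modulo_pow [Module.Finite R N] (hx : x ∈ maximalIdeal R) {i j : ℕ}
    (hi : i ≠ 0) (hj : j ≠ 0)
    {f : (M ⧸ (Ideal.span {x ^ i} • (⊤ : Submodule R M))) →ₗ[R]
      (N ⧸ (Ideal.span {x ^ i} • (⊤ : Submodule R N)))} (hf : Function.Surjective f)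
    {g : M →ₗ[R] N}
    (hg : ∀ m, ∃ n, f (Submodule.Quotient.mk m) = Submodule.Quotient.mk (g m + x ^ j • n)) :
    Function.Surjective g := by
  refine LinearMap.surjective_of_surjective_comp_mkQ g (maximalIdeal R)
    (maximalIdeal_le_jacobson _) fun y ↦ ?_
  obtain ⟨n, rfl⟩ := Submodule.Quotient.mk_surjective _ y
  obtain ⟨z, hz⟩ := hf (Submodule.Quotient.mk n)
  obtain ⟨m, rfl⟩ := Submodule.Quotient.mk_surjective _ z
  obtain ⟨n', hn'⟩ := hg m
  obtain ⟨w, hw⟩ := mem_span_singleton_smul_top.mp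
    ((Submodule.Quotient.eq _).mp (hn'.symm.trans hz))
  refine ⟨m, (Submodule.Quotient.eq _).mpr ?_⟩
  have : g m - n = x ^ i • w - x ^ j • n' := by rw [← hw]; abel
  rw [this]
  exact sub_mem (pow_smul_mem_maximalIdeal_smul_top hx hi w)
    (pow_smul_mem_maximalIdeal_smul_top hx hj n')

theorem eq_zero_of_isIdempotentElem_of_range_le {Q : Type*} [AddCommGroup Q] [Module R Q]
    [IsNoetherianRing R] [Module.Finite R Q] {f : Module.End R Q} (hf : IsIdempotentElem f)
    (h : ∀ q, f q ∈ maximalIdeal R • (⊤ : Submodule R Q)) : f = 0 := by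
  rw [← LinearMap.range_eq_bot]
  refine Submodule.eq_bot_of_le_smul_of_le_jacobson_bot (maximalIdeal R) _
    (IsNoetherian.noetherian _) ?_ (maximalIdeal_le_jacobson _)
  rintro _ ⟨q, rfl⟩
  have h1 := Submodule.mem_map_of_mem (f := f) (h q)
  rw [Submodule.map_smul'', Submodule.map_top] at h1
  rwa [← Module.End.mul_apply, hf.eq] at h1

theorem IsIndecomposableModule.quotient_span_pow_smul_top [IsNoetherianRing R]
    [IsAdicComplete (maximalIdeal R) R] [Module.Finite R M] (hM : IsIndecomposableModule R M)
    (hx : x ∈ maximalIdeal R) (hreg : IsSMulRegular M x) {k i : ℕ} (hki : k < i)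
    {F : Type*} [AddCommGroup F] [Module R F] [Module.Projective R F]
    {a : M →ₗ[R] F} {p : F →ₗ[R] M} (hpa : ∀ m, p (a m) = x ^ k • m) :
    IsIndecomposableModule R (M ⧸ (Ideal.span {x ^ i} • (⊤ : Submodule R M))) := by
  have : Nontrivial M := hM.1
  have hi : i ≠ 0 := by omega
  have hj : i - k ≠ 0 := by omega
  have := nontrivial_quotient_span_pow_smul_top (M := M) hx hi
  rw [isIndecomposableModule_iff_isIdempotentElem]
  intro f hf
  obtain ⟨g, hg⟩ := exists_lift_modulo_pow hreg hki.le hpa f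
  have hgg : ∀ m, ∃ n, (g ^ 2 - g) m = x ^ (i - k) • n := by
    intro m
    obtain ⟨n₁, h₁⟩ := hg m
    obtain ⟨n₂, h₂⟩ := hg (g m + x ^ (i - k) • n₁)
    rw [← h₁, ← Module.End.mul_apply, hf.eq, h₁] at h₂
    obtain ⟨w, hw⟩ := mem_span_singleton_smul_top.mp ((Submodule.Quotient.eq _).mp h₂)
    refine ⟨n₁ - g n₁ - n₂ - x ^ k • w, ?_⟩
    have hxw : x ^ (i - k) • x ^ k • w = x ^ i • w := by
      rw [smul_smul, ← pow_add, Nat.sub_add_cancel hki.le]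
    rw [smul_sub, smul_sub, smul_sub, hxw, ← hw, LinearMap.sub_apply, pow_two,
      Module.End.mul_apply, map_add, map_smul]
    abel
  obtain ⟨u, hu⟩ := LinearMap.exists_eq_smul_of_isSMulRegular (hreg.pow (i - k)) (g ^ 2 - g) hgg
  have hmk : ∀ m ∈ maximalIdeal R • (⊤ : Submodule R M),
      (Submodule.Quotient.mk m : M ⧸ (Ideal.span {x ^ i} • (⊤ : Submodule R M))) ∈
        maximalIdeal R • (⊤ : Submodule R (M ⧸ (Ideal.span {x ^ i} • (⊤ : Submodule R M)))) := by
    intro m hm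
    have h := Submodule.mem_map_of_mem
      (f := (Ideal.span {x ^ i} • (⊤ : Submodule R M)).mkQ) hm
    rw [Submodule.map_smul''] at h
    exact Submodule.smul_mono le_rfl le_top h
  rcases hM.apply_mem_smul_top (maximalIdeal R)
    (Ideal.pow_mem_of_mem _ hx _ (Nat.pos_of_ne_zero hj)) (hreg.pow _) hu with h | h
  · left
    refine eq_zero_of_isIdempotentElem_of_range_le hf fun q ↦ ?_
    obtain ⟨m, rfl⟩ := Submodule.Quotient.mk_surjective _ q
    obtain ⟨n, hn⟩ := hg m
    rw [hn]
    exact hmk _ (add_mem (h m) (pow_smul_mem_maximalIdeal_smul_top hx hj n))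
  · right
    refine (sub_eq_zero.mp (eq_zero_of_isIdempotentElem_of_range_le hf.one_sub fun q ↦ ?_)).symm
    obtain ⟨m, rfl⟩ := Submodule.Quotient.mk_surjective _ q
    obtain ⟨n, hn⟩ := hg m
    rw [LinearMap.sub_apply, hn, Module.End.one_apply, ← Submodule.Quotient.mk_sub, ← sub_sub]
    exact hmk _ (sub_mem (h m) (pow_smul_mem_maximalIdeal_smul_top hx hj n))

theorem nonempty_linearEquiv_of_surjective {R M N : Type*} [CommRing R] [AddCommGroup M]
    [Module R M] [AddCommGroup N] [Module R N] [Module.Finite R M] {g : M →ₗ[R] N}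
    {g' : N →ₗ[R] M} (hg : Function.Surjective g) (hg' : Function.Surjective g') :
    Nonempty (M ≃ₗ[R] N) := by
  have hinj : Function.Injective (g' ∘ₗ g) :=
    OrzechProperty.injective_of_surjective_endomorphism _ (hg'.comp hg)
  exact ⟨LinearEquiv.ofBijective g ⟨Function.Injective.of_comp hinj, hg⟩⟩

end Maranda

/-- Maranda-type theorem.  Let `R` be a Cohen-Macaulay complete Noetherian local ring
(`depth R = dim R`), and let `M` and `N` be nonisomorphic indecomposable finitely generated
maximal Cohen-Macaulay `R`-modules which are locally free at every nonmaximal prime.  For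
any nonzerodivisor `x` in the maximal ideal, there is an `i ≥ 1` such that `M/xⁱM` and
`N/xⁱN` are indecomposable and nonisomorphic. -/
theorem maranda_type
    (R : Type u) [CommRing R] [IsNoetherianRing R] [IsLocalRing R]
    [IsAdicComplete (IsLocalRing.maximalIdeal R) R]
    (hCM : (moduleDepth R R : WithBot ℕ∞) = ringKrullDim R)
    (M : Type u) [AddCommGroup M] [Module R M] [Module.Finite R M]
    (N : Type u) [AddCommGroup N] [Module R N] [Module.Finite R N]
    (hMCM : (moduleDepth R M : WithBot ℕ∞) = ringKrullDim R)
    (hNCM : (moduleDepth R N : WithBot ℕ∞) = ringKrullDim R)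
    (hlocM : ∀ (q : Ideal R) (_ : q.IsPrime), q ≠ IsLocalRing.maximalIdeal R →
      Module.Free (Localization.AtPrime q) (LocalizedModule q.primeCompl M))
    (hlocN : ∀ (q : Ideal R) (_ : q.IsPrime), q ≠ IsLocalRing.maximalIdeal R →
      Module.Free (Localization.AtPrime q) (LocalizedModule q.primeCompl N))
    (hindM : IsIndecomposableModule R M) (hindN : IsIndecomposableModule R N)
    (hMN : IsEmpty (M ≃ₗ[R] N))
    (x : R) (hx : x ∈ IsLocalRing.maximalIdeal R) (hxnzd : x ∈ nonZeroDivisors R) :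
    ∃ i : ℕ, 1 ≤ i ∧
      IsIndecomposableModule R (M ⧸ (Ideal.span {x ^ i} • (⊤ : Submodule R M))) ∧
      IsIndecomposableModule R (N ⧸ (Ideal.span {x ^ i} • (⊤ : Submodule R N))) ∧
      IsEmpty ((M ⧸ (Ideal.span {x ^ i} • (⊤ : Submodule R M))) ≃ₗ[R]
        (N ⧸ (Ideal.span {x ^ i} • (⊤ : Submodule R N)))) := by
  have hregM : IsSMulRegular M x := isSMulRegular_of_moduleDepth_eq hMCM hxnzd
  have hregN : IsSMulRegular N x := isSMulRegular_of_moduleDepth_eq hNCM hxnzd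
  obtain ⟨k, n, a, p, hpa⟩ := exists_pow_smul_factors_through_free hlocM hx
  obtain ⟨l, n', a', p', hpa'⟩ := exists_pow_smul_factors_through_free hlocN hx
  refine ⟨k + l + 1, by omega, hindM.quotient_span_pow_smul_top hx hregM (by omega) hpa,
    hindN.quotient_span_pow_smul_top hx hregN (by omega) hpa', ⟨fun f ↦ ?_⟩⟩
  obtain ⟨g, hg⟩ := exists_lift_modulo_pow hregN (by omega) hpa f.toLinearMap
  obtain ⟨g', hg'⟩ := exists_lift_modulo_pow hregM (by omega) hpa' f.symm.toLinearMap
  exact hMN.elim (nonempty_linearEquiv_of_surjective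
    (surjective_of_lift_modulo_pow hx (by omega) (by omega) f.surjective hg)
    (surjective_of_lift_modulo_pow hx (by omega) (by omega) f.symm.surjective hg')).some
end

section
/- Let R be a one-dimensional Cohen-Macaulay complete Noetherian local ring with maximal ideal m, and let M be an indecomposable finitely generated maximal Cohen-Macaulay R-module. Then there exists an irreducible morphism M → R in the category of finitely generated maximal Cohen-Macaulay R-modules if and only if M is isomorphic to a direct summand of m. If moreover R is Gorenstein, then there exists an irreducible morphism R → M if and only if M is isomorphic to a direct summand of Hom_R(m, R). -/
open CategoryTheory CategoryTheory.Abelian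

universe u

/-- A Noetherian local ring `R` is Gorenstein if it is Cohen-Macaulay (`depth R = dim R`)
and `Ext^{dim R}_R(k, R)` is one-dimensional over the residue field `k`; for
one-dimensional `R` the latter says that `Ext¹_R(k, R)` is nonzero and cyclic for the
action of `R` by composition (it is annihilated by the maximal ideal, so this means exactly
that it is a one-dimensional `k`-vector space). -/
def IsGorensteinOneDim (R : Type u) [CommRing R] [IsLocalRing R]
    [HasExt.{u} (ModuleCat.{u} R)] : Prop :=
  (moduleDepth R R : WithBot ℕ∞) = ringKrullDim R ∧
  ∃ e : Ext (ModuleCat.of R (IsLocalRing.ResidueField R)) (ModuleCat.of R R) 1, e ≠ 0 ∧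
    ∀ e' : Ext (ModuleCat.of R (IsLocalRing.ResidueField R)) (ModuleCat.of R R) 1,
      ∃ r : R, e' = e.comp (Ext.mk₀ (r • 𝟙 (ModuleCat.of R R))) (add_zero 1)

/-- A finitely generated module over a Noetherian local ring is maximal Cohen-Macaulay if
`depth M = dim R`. -/
def IsMCM (R : Type u) [CommRing R] [IsLocalRing R]
    (M : Type u) [AddCommGroup M] [Module R M] : Prop :=
  Module.Finite R M ∧ (moduleDepth R M : WithBot ℕ∞) = ringKrullDim R

/-- A morphism `f : X → Y` of (finitely generated maximal Cohen-Macaulay) modules is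
irreducible if it is neither a split monomorphism nor a split epimorphism, and whenever
`f = g ∘ h` with `h : X → L`, `g : L → Y` and `L` finitely generated maximal
Cohen-Macaulay, either `h` is a split monomorphism or `g` is a split epimorphism. -/
def IsIrreducibleHom (R : Type u) [CommRing R] [IsLocalRing R]
    {X Y : Type u} [AddCommGroup X] [Module R X] [AddCommGroup Y] [Module R Y]
    (f : X →ₗ[R] Y) : Prop :=
  (¬∃ r : Y →ₗ[R] X, r ∘ₗ f = LinearMap.id) ∧
  (¬∃ s : Y →ₗ[R] X, f ∘ₗ s = LinearMap.id) ∧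
  ∀ (L : Type u) (_ : AddCommGroup L) (_ : Module R L), IsMCM R L →
    ∀ (h : X →ₗ[R] L) (g : L →ₗ[R] Y), f = g ∘ₗ h →
      (∃ r : L →ₗ[R] X, r ∘ₗ h = LinearMap.id) ∨ (∃ s : Y →ₗ[R] L, g ∘ₗ s = LinearMap.id)

open IsLocalRing

section Artinian

variable {A : Type*} [CommRing A]

lemma length_eq_ker_add_range {M N : Type*} [AddCommGroup M] [Module A M] [AddCommGroup N]
    [Module A N] (F : M →ₗ[A] N) :
    Module.length A M = Module.length A (LinearMap.ker F) + Module.length A (LinearMap.range F) :=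
  Module.length_eq_add_of_exact (LinearMap.ker F).subtype (LinearMap.rangeRestrict F)
    (Submodule.subtype_injective _) (LinearMap.surjective_rangeRestrict F)
    (LinearMap.exact_iff.mpr (by rw [LinearMap.ker_rangeRestrict, Submodule.range_subtype]))

lemma length_eq_length_submodule_add_quotient {M : Type*} [AddCommGroup M] [Module A M]
    (N : Submodule A M) :
    Module.length A M = Module.length A N + Module.length A (M ⧸ N) :=
  Module.length_eq_add_of_exact N.subtype N.mkQ N.subtype_injective N.mkQ_surjective
    (LinearMap.exact_subtype_mkQ N)

lemma length_ker_lcomp_subtype_le {M : Type*} [AddCommGroup M] [Module A M]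
    (N : Submodule A M) :
    Module.length A (LinearMap.ker (LinearMap.lcomp A A N.subtype)) ≤
      Module.length A (M ⧸ N →ₗ[A] A) := by
  let G : (M ⧸ N →ₗ[A] A) →ₗ[A] LinearMap.ker (LinearMap.lcomp A A N.subtype) :=
    (LinearMap.lcomp A A N.mkQ).codRestrict _ (by
      intro φ
      rw [LinearMap.mem_ker]
      ext n
      have : N.mkQ n = 0 := (Submodule.Quotient.mk_eq_zero N).mpr n.2
      simp only [LinearMap.lcomp_apply, Submodule.subtype_apply, this, map_zero,
        LinearMap.zero_apply])
  refine Module.length_le_of_surjective G fun φ => ⟨N.liftQ φ.1 fun n hn => ?_, ?_⟩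
  · exact LinearMap.congr_fun (LinearMap.mem_ker.mp φ.2) ⟨n, hn⟩
  · exact Subtype.ext (LinearMap.ext fun _ => rfl)

variable [IsLocalRing A]

/-- If the socle of a local ring is cyclic, then `Hom(S, A)` has length at most one for every
simple module `S`. -/
lemma length_linearMap_le_one_of_isSimpleModule
    (hsoc : ∀ z t : A, (∀ y ∈ maximalIdeal A, y * z = 0) → (∀ y ∈ maximalIdeal A, y * t = 0) →
      z ≠ 0 → ∃ c : A, t = c * z)
    (S : Type*) [AddCommGroup S] [Module A S] [IsSimpleModule A S] :
    Module.length A (S →ₗ[A] A) ≤ 1 := by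
  rcases subsingleton_or_nontrivial (S →ₗ[A] A) with h | h
  · simp [Module.length_eq_zero]
  have hann : ∀ y ∈ maximalIdeal A, ∀ s : S, y • s = 0 := by
    intro y hy s
    have := IsLocalRing.eq_maximalIdeal (IsSimpleModule.annihilator_isMaximal (R := A) (M := S))
    rw [← this] at hy
    exact Module.mem_annihilator.mp hy s
  have : IsSimpleModule A (S →ₗ[A] A) := by
    rw [isSimpleModule_iff_toSpanSingleton_surjective]
    refine ⟨h, fun φ hφ ψ => ?_⟩
    obtain ⟨s, hs⟩ : ∃ s, φ s ≠ 0 := by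
      by_contra! H
      exact hφ (LinearMap.ext H)
    have hs0 : s ≠ 0 := by rintro rfl; simp at hs
    have key : ∀ (χ : S →ₗ[A] A), ∀ y ∈ maximalIdeal A, y * χ s = 0 := by
      intro χ y hy
      rw [← smul_eq_mul, ← map_smul, hann y hy, map_zero]
    obtain ⟨c, hc⟩ := hsoc _ _ (key φ) (key ψ) hs
    refine ⟨c, LinearMap.ext fun u => ?_⟩
    obtain ⟨a, rfl⟩ := IsSimpleModule.toSpanSingleton_surjective A hs0 u
    simp [hc, mul_left_comm]
  exact (Module.length_eq_one A (S →ₗ[A] A)).le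

/-- If the socle of a local ring `A` is cyclic, dualizing into `A` does not increase length. -/
lemma length_linearMap_le
    (hsoc : ∀ z t : A, (∀ y ∈ maximalIdeal A, y * z = 0) → (∀ y ∈ maximalIdeal A, y * t = 0) →
      z ≠ 0 → ∃ c : A, t = c * z)
    {N : Type*} [AddCommGroup N] [Module A N] (hN : IsFiniteLength A N) :
    Module.length A (N →ₗ[A] A) ≤ Module.length A N := by
  induction hN with
  | of_subsingleton => simp [Module.length_eq_zero]
  | @of_simple_quotient M _ _ N _ hN ih =>
    have hsimple := length_linearMap_le_one_of_isSimpleModule hsoc (M ⧸ N)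
    rw [length_eq_length_submodule_add_quotient N, Module.length_eq_one A (M ⧸ N)]
    let F : (M →ₗ[A] A) →ₗ[A] (N →ₗ[A] A) := LinearMap.lcomp A A N.subtype
    rw [length_eq_ker_add_range F, add_comm]
    refine add_le_add ((Module.length_le_of_injective (LinearMap.range F).subtype
      (Submodule.subtype_injective _)).trans ih)
      ((length_ker_lcomp_subtype_le N).trans hsimple)

/-- An Artinian local ring with cyclic socle is self-injective. -/
lemma baer_self_of_socle_cyclic [IsArtinianRing A]
    (hsoc : ∀ z t : A, (∀ y ∈ maximalIdeal A, y * z = 0) → (∀ y ∈ maximalIdeal A, y * t = 0) →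
      z ≠ 0 → ∃ c : A, t = c * z) :
    Module.Baer A A := by
  rw [Module.Baer.iff_surjective]
  intro I
  let F : (A →ₗ[A] A) →ₗ[A] (I →ₗ[A] A) := LinearMap.lcomp A A I.subtype
  have hA : IsFiniteLength A A := (isArtinianRing_iff_isFiniteLength A).mp inferInstance
  have hfin : ∀ J : Ideal A, Module.length A J ≠ ⊤ := fun J => Module.length_ne_top
  have hlen := length_eq_ker_add_range F
  have hlenA := length_eq_length_submodule_add_quotient I
  rw [(LinearMap.ringLmapEquivSelf A A A).length_eq, hlenA] at hlen
  have hq : IsFiniteLength A (A ⧸ I) := hA.of_surjective I.mkQ_surjective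
  have hker : Module.length A (LinearMap.ker F) ≤ Module.length A (A ⧸ I) :=
    (length_ker_lcomp_subtype_le I).trans (length_linearMap_le hsoc hq)
  have hqtop : Module.length A (A ⧸ I) ≠ ⊤ := Module.length_ne_top
  have hrange : Module.length A I ≤ Module.length A (LinearMap.range F) := by
    have h1 : Module.length A I + Module.length A (A ⧸ I) ≤
        Module.length A (LinearMap.range F) + Module.length A (A ⧸ I) := by
      rw [hlen, add_comm]; gcongr
    exact (ENat.add_le_add_iff_right hqtop).mp h1
  have hI : IsFiniteLength A I := hA.of_injective I.subtype_injective
  have hHomI := length_linearMap_le hsoc hI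
  have hsum := length_eq_length_submodule_add_quotient (LinearMap.range F)
  have hz : Module.length A ((I →ₗ[A] A) ⧸ LinearMap.range F) = 0 := by
    have h2 : Module.length A I + Module.length A ((I →ₗ[A] A) ⧸ LinearMap.range F) ≤
        Module.length A I + 0 := by
      rw [add_zero]
      refine le_trans ?_ hHomI
      rw [hsum]; gcongr
    exact le_antisymm ((ENat.add_le_add_iff_left (hfin I)).mp h2) bot_le
  rw [Module.length_eq_zero_iff, Submodule.Quotient.subsingleton_iff] at hz
  exact LinearMap.range_eq_top.mp hz

end Artinian

section Depth

variable {R : Type u} [CommRing R] [IsLocalRing R]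

lemma IsMCM.exists_isSMulRegular {M : Type u} [AddCommGroup M] [Module R M]
    (hdim : ringKrullDim R = 1) (hM : (moduleDepth R M : WithBot ℕ∞) = ringKrullDim R) :
    ∃ x ∈ maximalIdeal R, IsSMulRegular M x := by
  by_contra! H
  have h0 : moduleDepth R M ≤ 0 := by
    refine iSup_le fun rs => iSup_le fun hreg => iSup_le fun hmem => ?_
    cases rs with
    | nil => simp
    | cons r rs =>
      exact absurd ((RingTheory.Sequence.isRegular_cons_iff M r rs).mp hreg).1
        (H r (hmem r (by simp)))
  rw [hdim] at hM
  rw [nonpos_iff_eq_zero.mp h0] at hM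
  exact absurd hM (by norm_num)

variable [IsNoetherianRing R]

lemma isMCM_of_isSMulRegular {M : Type u} [AddCommGroup M] [Module R M]
    (hdim : ringKrullDim R = 1) [Module.Finite R M] [Nontrivial M] {x : R}
    (hx : x ∈ maximalIdeal R) (hreg : IsSMulRegular M x) : IsMCM R M := by
  refine ⟨inferInstance, ?_⟩
  rw [hdim]
  suffices moduleDepth R M = 1 by rw [this]; rfl
  apply le_antisymm
  · refine iSup_le fun rs => iSup_le fun hreg => iSup_le fun hmem => ?_
    have h1 := Module.supportDim_add_length_eq_supportDim_of_isRegular rs hreg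
    have h2 := Module.supportDim_le_ringKrullDim R M
    rw [hdim, ← h1] at h2
    have : Nontrivial (M ⧸ Ideal.ofList rs • (⊤ : Submodule R M)) :=
      Submodule.Quotient.nontrivial_iff.mpr hreg.top_ne_smul.symm
    have : Nonempty (Module.support R (M ⧸ Ideal.ofList rs • (⊤ : Submodule R M))) :=
      Module.nonempty_support_of_nontrivial.to_subtype
    have h3 : 0 ≤ Module.supportDim R (M ⧸ Ideal.ofList rs • (⊤ : Submodule R M)) :=
      Order.krullDim_nonneg
    have h4 : ((rs.length : ℕ∞) : WithBot ℕ∞) ≤ ((1 : ℕ∞) : WithBot ℕ∞) := by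
      refine le_trans ?_ h2
      exact le_add_of_nonneg_left h3
    exact WithBot.coe_le_coe.mp h4
  · have hr : RingTheory.Sequence.IsRegular M [x] := by
      refine ⟨(RingTheory.Sequence.isWeaklyRegular_singleton_iff M x).mpr hreg, fun h => ?_⟩
      have hle : Ideal.ofList [x] ≤ Ideal.jacobson ⊥ := by
        rw [Ideal.ofList_singleton, Ideal.span_singleton_le_iff_mem]
        exact IsLocalRing.maximalIdeal_le_jacobson _ hx
      have := Submodule.eq_bot_of_le_smul_of_le_jacobson_bot _ _ Module.Finite.fg_top h.le hle
      exact top_ne_bot this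
    refine le_trans (by simp) (le_iSup₂_of_le [x] hr (le_iSup_of_le (by simpa using hx) le_rfl))

lemma isArtinianRing_quotient_span_singleton (hdim : ringKrullDim R = 1) {x : R}
    (hx : x ∈ maximalIdeal R) (hreg : IsSMulRegular R x) :
    IsArtinianRing (R ⧸ Ideal.span {x}) := by
  have h := ringKrullDim_quotient_span_singleton_succ_eq_ringKrullDim hreg hx
  rw [hdim] at h
  have h0 : ringKrullDim (R ⧸ Ideal.span {x}) ≤ 0 :=
    ENat.WithBot.add_le_add_one_right_iff.mp (by rw [h, zero_add])
  have : Ring.KrullDimLE 0 (R ⧸ Ideal.span {x}) := Ring.krullDimLE_iff.mpr h0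
  exact IsNoetherianRing.isArtinianRing_of_krullDimLE_zero

lemma exists_maximalIdeal_pow_le_span_singleton (hdim : ringKrullDim R = 1) {x : R}
    (hx : x ∈ maximalIdeal R) (hreg : IsSMulRegular R x) :
    ∃ n, maximalIdeal R ^ n ≤ Ideal.span {x} := by
  have := isArtinianRing_quotient_span_singleton hdim hx hreg
  have hne : Ideal.span {x} ≠ ⊤ := by
    rw [Ne, Ideal.span_singleton_eq_top]; exact (mem_maximalIdeal _).mp hx
  have : Nontrivial (R ⧸ Ideal.span {x}) := Ideal.Quotient.nontrivial_iff.mpr hne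
  have : IsLocalRing (R ⧸ Ideal.span {x}) :=
    IsLocalRing.of_surjective' (Ideal.Quotient.mk _) Ideal.Quotient.mk_surjective
  obtain ⟨n, hn⟩ := IsArtinianRing.isNilpotent_jacobson_bot (R := R ⧸ Ideal.span {x})
  rw [IsLocalRing.jacobson_eq_maximalIdeal _ bot_ne_top] at hn
  refine ⟨n, ?_⟩
  rw [← Ideal.mk_ker (I := Ideal.span {x}), RingHom.ker_eq_comap_bot, ← Ideal.map_le_iff_le_comap,
    Ideal.map_pow]
  have hmap : (maximalIdeal R).map (Ideal.Quotient.mk (Ideal.span {x})) ≤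
      maximalIdeal (R ⧸ Ideal.span {x}) :=
    ((IsLocalRing.local_hom_TFAE (Ideal.Quotient.mk (Ideal.span {x}))).out 0 2).mp
      (IsLocalHom.of_surjective _ Ideal.Quotient.mk_surjective)
  exact (Ideal.pow_right_mono hmap n).trans hn.le

/-- Over a one-dimensional Noetherian local ring, every non-unit that is regular on the ring is
regular on every maximal Cohen-Macaulay module. -/
lemma IsMCM.isSMulRegular {M : Type u} [AddCommGroup M] [Module R M] (hdim : ringKrullDim R = 1)
    (hM : IsMCM R M) {x : R} (hx : x ∈ maximalIdeal R) (hreg : IsSMulRegular R x) :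
    IsSMulRegular M x := by
  obtain ⟨y, hy, hyreg⟩ := IsMCM.exists_isSMulRegular hdim hM.2
  obtain ⟨n, hn⟩ := exists_maximalIdeal_pow_le_span_singleton hdim hx hreg
  obtain ⟨c, hc⟩ := Ideal.mem_span_singleton'.mp (hn (Ideal.pow_mem_pow hy n))
  exact IsSMulRegular.of_mul (a := c) (by rw [hc]; exact hyreg.pow n)

end Depth

section Lifting

variable {R : Type*} [CommRing R]

/-- A linear map all of whose values are divisible by a regular element can be divided by it. -/
lemma exists_linearMap_smul_eq {N P : Type*} [AddCommGroup N] [Module R N] [AddCommGroup P]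
    [Module R P] {x : R} (hx : IsSMulRegular P x) (g : N →ₗ[R] P) (hg : ∀ n, ∃ v, x • v = g n) :
    ∃ φ : N →ₗ[R] P, ∀ n, x • φ n = g n := by
  choose v hv using hg
  refine ⟨{ toFun := v, map_add' := fun a b => hx ?_, map_smul' := fun r a => hx ?_ }, hv⟩
  · simp only [smul_add, hv, map_add]
  · simp only [RingHom.id_apply, smul_comm x r, hv, map_smul]

/-- If `R ⧸ (x)` is self-injective, maps into it extend along maps that are injective
modulo `x`. -/
lemma exists_extension_of_baer_quotient {x : R}
    (hB : Module.Baer (R ⧸ Ideal.span {x}) (R ⧸ Ideal.span {x}))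
    {N F : Type*} [AddCommGroup N] [Module R N] [AddCommGroup F] [Module R F]
    (i : N →ₗ[R] F) (hi : ∀ n f, i n = x • f → ∃ n', n = x • n')
    (φ : N →ₗ[R] R ⧸ Ideal.span {x}) : ∃ ψ : F →ₗ[R] R ⧸ Ideal.span {x}, ψ ∘ₗ i = φ := by
  have hsurj : Function.Surjective (algebraMap R (R ⧸ Ideal.span {x})) :=
    Ideal.Quotient.mk_surjective
  have hle : (Ideal.span {x} • ⊤ : Submodule R N) ≤
      (Ideal.span {x} • ⊤ : Submodule R F).comap i := by
    rw [← Submodule.map_le_iff_le_comap, Submodule.map_smul'']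
    exact smul_mono_right _ le_top
  have hker : (Ideal.span {x} • ⊤ : Submodule R N) ≤ LinearMap.ker φ := by
    rw [Submodule.ideal_span_singleton_smul]
    rintro _ ⟨n, -, rfl⟩
    obtain ⟨r, hr⟩ := Ideal.Quotient.mk_surjective (φ n)
    simp only [DistribSMul.toLinearMap_apply, LinearMap.mem_ker, map_smul]
    rw [← hr, ← Ideal.Quotient.mk_eq_mk, ← Submodule.Quotient.mk_smul,
      Submodule.Quotient.mk_eq_zero, smul_eq_mul]
    exact Ideal.mul_mem_right _ _ (Ideal.mem_span_singleton_self x)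
  let i' := (Ideal.span {x} • ⊤ : Submodule R N).mapQ (Ideal.span {x} • ⊤ : Submodule R F) i hle
  let φ' := (Ideal.span {x} • ⊤ : Submodule R N).liftQ φ hker
  have hi' : Function.Injective i' := by
    rw [injective_iff_map_eq_zero]
    intro q hq
    obtain ⟨n, rfl⟩ := Submodule.Quotient.mk_surjective _ q
    simp only [i', Submodule.mapQ_apply, Submodule.Quotient.mk_eq_zero] at hq
    rw [Submodule.ideal_span_singleton_smul] at hq
    obtain ⟨f, -, hf⟩ := hq
    obtain ⟨n', rfl⟩ := hi n f hf.symm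
    rw [Submodule.Quotient.mk_eq_zero]
    exact Submodule.smul_mem_smul (Ideal.mem_span_singleton_self x) trivial
  obtain ⟨ψ, hψ⟩ := hB.extension_property (i'.extendScalarsOfSurjective hsurj) hi'
    (φ'.extendScalarsOfSurjective hsurj)
  refine ⟨ψ.restrictScalars R ∘ₗ (Ideal.span {x} • ⊤ : Submodule R F).mkQ, LinearMap.ext fun n => ?_⟩
  exact LinearMap.congr_fun hψ (Submodule.Quotient.mk n)

lemma exists_smul_eq_of_mk_eq {x a b : R}
    (h : Ideal.Quotient.mk (Ideal.span {x}) a = Ideal.Quotient.mk (Ideal.span {x}) b) :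
    ∃ c, x • c = a - b := by
  obtain ⟨c, hc⟩ := Ideal.mem_span_singleton.mp (Ideal.Quotient.eq.mp h)
  exact ⟨c, hc.symm⟩

variable [IsLocalRing R] [IsNoetherianRing R]

/-- If `R ⧸ (x)` is self-injective, `R`-valued maps extend from `K` to a finite free module `F`
whenever `x` is regular on `F ⧸ K`. -/
lemma exists_extension_of_regular {x : R} (hxm : x ∈ maximalIdeal R) (hx : IsSMulRegular R x)
    (hB : Module.Baer (R ⧸ Ideal.span {x}) (R ⧸ Ideal.span {x}))
    {F : Type*} [AddCommGroup F] [Module R F] [Module.Finite R F] [Module.Free R F]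
    (K : Submodule R F) (hK : ∀ f, x • f ∈ K → f ∈ K) (φ : K →ₗ[R] R) :
    ∃ ψ : F →ₗ[R] R, ψ ∘ₗ K.subtype = φ := by
  have hfin : Module.Finite R (K →ₗ[R] R) := by
    obtain ⟨n, p, hp⟩ := Module.Finite.exists_fin' R K
    refine Module.Finite.of_injective (LinearMap.lcomp R R p) fun a b hab => ?_
    exact (LinearMap.cancel_right hp).mp hab
  let Λ : (F →ₗ[R] R) →ₗ[R] (K →ₗ[R] R) := LinearMap.lcomp R R K.subtype
  suffices h : (⊤ : Submodule R (K →ₗ[R] R)) ≤ LinearMap.range Λ from h (x := φ) trivial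
  refine Submodule.le_of_le_smul_of_le_jacobson_bot hfin.fg_top
    (IsLocalRing.maximalIdeal_le_jacobson ⊥) fun χ _ => ?_
  obtain ⟨ψ', hψ'⟩ := exists_extension_of_baer_quotient hB K.subtype
    (fun n f h => ⟨⟨f, hK f (h ▸ n.2)⟩, Subtype.ext h⟩)
    ((Ideal.span {x}).mkQ ∘ₗ χ)
  obtain ⟨ψ, rfl⟩ := Module.projective_lifting_property (Ideal.span {x}).mkQ ψ'
    (Submodule.mkQ_surjective _)
  obtain ⟨χ₁, hχ₁⟩ := exists_linearMap_smul_eq hx (χ - Λ ψ)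
    (fun n => exists_smul_eq_of_mk_eq (LinearMap.congr_fun hψ' n).symm)
  have : χ = Λ ψ + x • χ₁ := by
    ext n
    rw [LinearMap.add_apply, LinearMap.smul_apply, hχ₁, LinearMap.sub_apply, add_sub_cancel]
  rw [this]
  exact Submodule.add_mem_sup ⟨ψ, rfl⟩ (Submodule.smul_mem_smul hxm trivial)

/-- If `R ⧸ (x)` is self-injective and `l ∈ L` generates a copy of `R ⧸ (x)` inside `L ⧸ xL`,
some linear form on `L` takes a value congruent to `1` modulo `x` at `l`. -/
lemma exists_linearForm_sub_one_mem {x : R} (hxm : x ∈ maximalIdeal R) (hx : IsSMulRegular R x)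
    (hB : Module.Baer (R ⧸ Ideal.span {x}) (R ⧸ Ideal.span {x}))
    {L : Type*} [AddCommGroup L] [Module R L] [Module.Finite R L] (hL : IsSMulRegular L x)
    (l : L) (hl : ∀ (r : R) (v : L), r • l = x • v → ∃ r', r = x • r') :
    ∃ s : L →ₗ[R] R, s l - 1 ∈ maximalIdeal R := by
  obtain ⟨ψ₀, hψ₀⟩ := exists_extension_of_baer_quotient hB (LinearMap.toSpanSingleton R L l)
    hl (Ideal.span {x}).mkQ
  obtain ⟨n, p, hp⟩ := Module.Finite.exists_fin' R L
  obtain ⟨ψ, hψ⟩ := Module.projective_lifting_property (Ideal.span {x}).mkQ (ψ₀ ∘ₗ p)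
    (Submodule.mkQ_surjective _)
  obtain ⟨φ, hφ⟩ := exists_linearMap_smul_eq hx (ψ ∘ₗ (LinearMap.ker p).subtype) (fun k => by
    have h1 := LinearMap.congr_fun hψ k
    have h2 : p k = 0 := k.2
    simp only [LinearMap.comp_apply, h2, map_zero] at h1
    obtain ⟨c, hc⟩ := exists_smul_eq_of_mk_eq (x := x) (a := ψ k) (b := 0) (by
      rw [map_zero]; exact h1)
    exact ⟨c, by simpa using hc⟩)
  obtain ⟨φ', rfl⟩ := exists_extension_of_regular hxm hx hB (LinearMap.ker p) (fun f hf => by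
    rw [LinearMap.mem_ker, map_smul] at hf
    exact hL (by simpa using hf)) φ
  let e := LinearMap.quotKerEquivOfSurjective p hp
  let s : L →ₗ[R] R := (LinearMap.ker p).liftQ (ψ - x • φ') (fun k hk => by
    simpa [sub_eq_zero] using (hφ ⟨k, hk⟩).symm) ∘ₗ e.symm.toLinearMap
  have hs : ∀ f, s (p f) = ψ f - x * φ' f := by
    intro f
    have : e.symm (p f) = Submodule.Quotient.mk f := by
      rw [LinearEquiv.symm_apply_eq]; rfl
    simp [s, this]
  refine ⟨s, ?_⟩
  obtain ⟨f, rfl⟩ := hp l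
  rw [hs]
  have h1 : Ideal.Quotient.mk (Ideal.span {x}) (ψ f) = Ideal.Quotient.mk _ 1 := by
    refine (LinearMap.congr_fun hψ f).trans ?_
    have := LinearMap.congr_fun hψ₀ 1
    simpa using this
  obtain ⟨c, hc⟩ := exists_smul_eq_of_mk_eq h1
  have : ψ f - x * φ' f - 1 = (c - φ' f) * x := by
    rw [smul_eq_mul] at hc
    linear_combination -hc
  rw [this]
  exact Ideal.mul_mem_left _ _ hxm

end Lifting

section Gorenstein

open Pointwise

variable {R : Type u} [CommRing R]

lemma quotSMulTop_mk_eq_zero_iff {x z : R} :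
    (Submodule.Quotient.mk z : QuotSMulTop x R) = 0 ↔ x ∣ z := by
  rw [Submodule.Quotient.mk_eq_zero, Submodule.mem_smul_pointwise_iff_exists]
  exact ⟨fun ⟨c, _, hc⟩ => ⟨c, hc.symm⟩, fun ⟨c, hc⟩ => ⟨c, trivial, hc.symm⟩⟩

variable [IsLocalRing R]

/-- An element of `R` killed by the maximal ideal modulo `x` gives a map from the residue field. -/
lemma exists_residueField_hom {x z : R} (hz : ∀ y ∈ maximalIdeal R, x ∣ y * z) :
    ∃ f : ResidueField R →ₗ[R] QuotSMulTop x R, f 1 = Submodule.Quotient.mk z := by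
  let f : R ⧸ maximalIdeal R →ₗ[R] QuotSMulTop x R :=
    (maximalIdeal R).liftQ (LinearMap.toSpanSingleton R _ (Submodule.Quotient.mk z))
      (fun y hy => by
        obtain ⟨c, hc⟩ := hz y hy
        rw [LinearMap.mem_ker, LinearMap.toSpanSingleton_apply, ← Submodule.Quotient.mk_smul,
          Submodule.Quotient.mk_eq_zero, Submodule.mem_smul_pointwise_iff_exists]
        exact ⟨c, trivial, hc.symm⟩)
  refine ⟨f, ?_⟩
  exact one_smul R (Submodule.Quotient.mk z : QuotSMulTop x R)

/-- For a one-dimensional Gorenstein ring and a regular non-unit `x`, the socle of `R ⧸ (x)` is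
cyclic. -/
lemma IsGorensteinOneDim.socle_cyclic [HasExt.{u} (ModuleCat.{u} R)]
    (hG : IsGorensteinOneDim R) {x : R} (hxm : x ∈ maximalIdeal R) (hx : IsSMulRegular R x)
    (z t : R) (hz : ∀ y ∈ maximalIdeal R, x ∣ y * z) (ht : ∀ y ∈ maximalIdeal R, x ∣ y * t)
    (hz0 : ¬ x ∣ z) : ∃ c, x ∣ t - c * z := by
  obtain ⟨-, e, -, he⟩ := hG
  have hS := IsSMulRegular.smulShortComplex_shortExact (M := ModuleCat.of R R) hx
  have hsmul : ∀ y ∈ maximalIdeal R, ∀ a : R, y • (a • e) = 0 := by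
    intro y hy a
    have h0 : y • 𝟙 (ModuleCat.of R (ResidueField R)) = 0 := by
      ext u
      obtain ⟨w, rfl⟩ := IsLocalRing.residue_surjective u
      change y • residue R w = 0
      rw [Algebra.smul_def, ResidueField.algebraMap_eq, (residue_eq_zero_iff y).mpr hy, zero_mul]
    rw [← Ext.mk₀_id_comp (a • e), ← Ext.smul_comp, ← Ext.mk₀_smul, h0, Ext.mk₀_zero,
      Ext.zero_comp]
  have hhom : ∀ g : ModuleCat.of R (ResidueField R) ⟶ ModuleCat.of R R, g = 0 := by
    intro g
    ext u
    apply hx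
    have hu : x • (u : ResidueField R) = 0 := by
      rw [Algebra.smul_def, ResidueField.algebraMap_eq, (residue_eq_zero_iff x).mpr hxm, zero_mul]
    change x • g.hom u = x • (0 : R)
    rw [smul_zero]
    exact (g.hom.map_smul x u).symm.trans ((congrArg g.hom hu).trans (map_zero g.hom))
  obtain ⟨δ, hδ⟩ : ∃ δ : Ext (ModuleCat.of R (QuotSMulTop x R)) (ModuleCat.of R R) 1,
      ∀ f : ResidueField R →ₗ[R] QuotSMulTop x R,
        (Ext.mk₀ (ModuleCat.ofHom f)).comp δ (zero_add 1) = 0 → f = 0 := by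
    refine ⟨hS.extClass, fun f hf => ?_⟩
    obtain ⟨g, hg⟩ := Ext.covariant_sequence_exact₃ _ hS _ (zero_add 1) hf
    obtain ⟨g, rfl⟩ := (Ext.mk₀_bijective _ _).2 g
    have hg0 : g = 0 := hhom g
    rw [hg0, Ext.mk₀_zero, Ext.zero_comp] at hg
    exact congrArg ModuleCat.Hom.hom ((Ext.mk₀_eq_zero_iff _).mp hg.symm)
  obtain ⟨f, hf⟩ := exists_residueField_hom hz
  obtain ⟨g, hg⟩ := exists_residueField_hom ht
  obtain ⟨r, hr⟩ := he ((Ext.mk₀ (ModuleCat.ofHom f)).comp δ (zero_add 1))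
  obtain ⟨s, hs⟩ := he ((Ext.mk₀ (ModuleCat.ofHom g)).comp δ (zero_add 1))
  rw [← Ext.smul_eq_comp_mk₀] at hr hs
  by_cases hru : IsUnit r
  · obtain ⟨r, rfl⟩ := hru
    have h := hδ (g - (s * ↑r⁻¹ : R) • f) (by
      have hsub : ModuleCat.ofHom (g - (s * ↑r⁻¹ : R) • f) =
          ModuleCat.ofHom g + (-(s * ↑r⁻¹ : R)) • ModuleCat.ofHom f := by
        rw [neg_smul, ← sub_eq_add_neg]; rfl
      rw [hsub, Ext.mk₀_add, Ext.add_comp, Ext.mk₀_smul, Ext.smul_comp, hr, hs, smul_smul,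
        ← add_smul, neg_mul, mul_assoc, Units.inv_mul, mul_one, add_neg_cancel, zero_smul])
    refine ⟨s * ↑r⁻¹, quotSMulTop_mk_eq_zero_iff.mp ?_⟩
    have := LinearMap.congr_fun h 1
    rwa [LinearMap.sub_apply, LinearMap.smul_apply, hf, hg] at this
  · have hre := hsmul r ((mem_maximalIdeal r).mpr hru) 1
    rw [one_smul] at hre
    have h := hδ f (hr.trans hre)
    rw [h] at hf
    exact absurd (quotSMulTop_mk_eq_zero_iff.mp hf.symm) hz0

/-- Every nonzero element of `R ⧸ (x)` has a nonzero multiple in the socle, provided a power of the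
maximal ideal lies in `(x)`. -/
lemma exists_mul_socle {x : R} {n : ℕ} (hn : maximalIdeal R ^ n ≤ Ideal.span {x}) {r : R}
    (hr : ¬ x ∣ r) : ∃ a, ¬ x ∣ a * r ∧ ∀ y ∈ maximalIdeal R, x ∣ y * (a * r) := by
  classical
  have hex : ∃ n, ∀ y ∈ maximalIdeal R ^ n, x ∣ y * r :=
    ⟨n, fun y hy => (Ideal.mem_span_singleton.mp (hn hy)).mul_right r⟩
  obtain ⟨k, hk⟩ : ∃ k, Nat.find hex = k + 1 := by
    refine Nat.exists_eq_succ_of_ne_zero fun h0 => hr ?_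
    have := Nat.find_spec hex 1
    rw [h0] at this
    simpa using this
  have hk' := Nat.find_min hex (m := k) (by omega)
  push Not at hk'
  obtain ⟨a, ha, har⟩ := hk'
  refine ⟨a, har, fun y hy => ?_⟩
  rw [← mul_assoc]
  refine Nat.find_spec hex _ ?_
  rw [hk, pow_succ']
  exact Ideal.mul_mem_mul hy ha

variable [IsNoetherianRing R]

lemma baer_quotient_of_socle_cyclic (hdim : ringKrullDim R = 1) {x : R}
    (hxm : x ∈ maximalIdeal R) (hx : IsSMulRegular R x)
    (hsoc : ∀ z t : R, (∀ y ∈ maximalIdeal R, x ∣ y * z) → (∀ y ∈ maximalIdeal R, x ∣ y * t) →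
      ¬ x ∣ z → ∃ c, x ∣ t - c * z) :
    Module.Baer (R ⧸ Ideal.span {x}) (R ⧸ Ideal.span {x}) := by
  have := isArtinianRing_quotient_span_singleton hdim hxm hx
  have : Nontrivial (R ⧸ Ideal.span {x}) := Ideal.Quotient.nontrivial_iff.mpr (by
    rw [Ne, Ideal.span_singleton_eq_top]; exact (mem_maximalIdeal _).mp hxm)
  have : IsLocalRing (R ⧸ Ideal.span {x}) :=
    IsLocalRing.of_surjective' (Ideal.Quotient.mk _) Ideal.Quotient.mk_surjective
  have hmap : (maximalIdeal R).map (Ideal.Quotient.mk (Ideal.span {x})) ≤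
      maximalIdeal (R ⧸ Ideal.span {x}) :=
    ((IsLocalRing.local_hom_TFAE (Ideal.Quotient.mk (Ideal.span {x}))).out 0 2).mp
      (IsLocalHom.of_surjective _ Ideal.Quotient.mk_surjective)
  have hdvd : ∀ a : R, Ideal.Quotient.mk (Ideal.span {x}) a = 0 ↔ x ∣ a := fun a => by
    rw [Ideal.Quotient.eq_zero_iff_mem, Ideal.mem_span_singleton]
  have hann : ∀ z : R, (∀ y ∈ maximalIdeal (R ⧸ Ideal.span {x}), y * Ideal.Quotient.mk _ z = 0) →
      ∀ y ∈ maximalIdeal R, x ∣ y * z := fun z hz y hy => by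
    rw [← hdvd, map_mul]
    exact hz _ (hmap (Ideal.mem_map_of_mem _ hy))
  refine baer_self_of_socle_cyclic fun z t hz ht hz0 => ?_
  obtain ⟨z, rfl⟩ := Ideal.Quotient.mk_surjective z
  obtain ⟨t, rfl⟩ := Ideal.Quotient.mk_surjective t
  obtain ⟨c, hc⟩ := hsoc z t (hann z hz) (hann t ht) (by rwa [Ne, hdvd] at hz0)
  refine ⟨Ideal.Quotient.mk _ c, ?_⟩
  rw [← sub_eq_zero, ← map_mul, ← map_sub, hdvd]
  exact hc

/-- The inclusion `R → Hom(m, R)` is left almost split when `R` is Gorenstein: every map `R → L`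
that is not a split monomorphism extends along it. -/
lemma exists_extension_dual_maximalIdeal (hdim : ringKrullDim R = 1) {x : R}
    (hxm : x ∈ maximalIdeal R) (hx : IsSMulRegular R x)
    (hsoc : ∀ z t : R, (∀ y ∈ maximalIdeal R, x ∣ y * z) → (∀ y ∈ maximalIdeal R, x ∣ y * t) →
      ¬ x ∣ z → ∃ c, x ∣ t - c * z)
    {L : Type*} [AddCommGroup L] [Module R L] [Module.Finite R L] (hL : IsSMulRegular L x)
    (h : R →ₗ[R] L) (hns : ¬ ∃ s : L →ₗ[R] R, s ∘ₗ h = LinearMap.id) :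
    ∃ h' : (maximalIdeal R →ₗ[R] R) →ₗ[R] L, h' (maximalIdeal R).subtype = h 1 := by
  have hB := baer_quotient_of_socle_cyclic hdim hxm hx hsoc
  obtain ⟨n, hn⟩ := exists_maximalIdeal_pow_le_span_singleton hdim hxm hx
  have key : ∀ u : R, (∀ y ∈ maximalIdeal R, x ∣ y * u) → ∃ v, x • v = u • h 1 := by
    intro u hu
    by_contra hcon
    obtain ⟨s, hs⟩ := exists_linearForm_sub_one_mem hxm hx hB hL (h 1) (fun r v hrv => by
      by_contra hr
      obtain ⟨a, ha, hsa⟩ := exists_mul_socle hn (r := r) hr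
      obtain ⟨c, d, hd⟩ := hsoc (a * r) u hsa hu ha
      refine hcon ⟨(c * a) • v + d • h 1, ?_⟩
      rw [smul_add, smul_comm x, ← hrv, smul_smul, smul_smul, ← add_smul]
      congr 1
      linear_combination -hd)
    have hunit : IsUnit (s (h 1)) := by
      by_contra hnu
      have := (maximalIdeal R).sub_mem ((mem_maximalIdeal _).mpr hnu) hs
      rw [sub_sub_cancel] at this
      exact (mem_maximalIdeal _).mp this isUnit_one
    obtain ⟨w, hw⟩ := hunit
    refine hns ⟨(↑w⁻¹ : R) • s, LinearMap.ext_ring ?_⟩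
    simp [← hw]
  let g : (maximalIdeal R →ₗ[R] R) →ₗ[R] L :=
    (LinearMap.toSpanSingleton R L (h 1)) ∘ₗ LinearMap.applyₗ ⟨x, hxm⟩
  obtain ⟨h', hh'⟩ := exists_linearMap_smul_eq hL g (fun φ => key _ fun y hy => by
    refine ⟨φ ⟨y, hy⟩, ?_⟩
    have hcomm : x • (⟨y, hy⟩ : maximalIdeal R) = y • ⟨x, hxm⟩ := Subtype.ext (mul_comm _ _)
    have hφ := congrArg φ hcomm
    rw [map_smul, map_smul] at hφ
    exact hφ.symm)
  exact ⟨h', hL (hh' _)⟩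

end Gorenstein

section AlmostSplit

variable {R : Type u} [CommRing R] [IsLocalRing R]

/-- A linear map to a local ring that is not a split epimorphism takes values in the maximal
ideal. -/
lemma exists_subtype_comp_eq_of_not_split {N : Type*} [AddCommGroup N] [Module R N]
    (f : N →ₗ[R] R) (hf : ¬ ∃ s : R →ₗ[R] N, f ∘ₗ s = LinearMap.id) :
    ∃ f' : N →ₗ[R] maximalIdeal R, f = (maximalIdeal R).subtype ∘ₗ f' := by
  refine ⟨f.codRestrict (maximalIdeal R) fun v => ?_, rfl⟩
  rw [mem_maximalIdeal]
  intro hv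
  obtain ⟨r, hr⟩ := hv
  refine hf ⟨LinearMap.toSpanSingleton R N ((↑r⁻¹ : R) • v), LinearMap.ext_ring ?_⟩
  simp [← hr]

lemma not_split_subtype_comp {N : Type*} [AddCommGroup N] [Module R N]
    (f : N →ₗ[R] maximalIdeal R) :
    ¬ ∃ s : R →ₗ[R] N, ((maximalIdeal R).subtype ∘ₗ f) ∘ₗ s = LinearMap.id := by
  rintro ⟨s, hs⟩
  have h : ((f (s 1) : maximalIdeal R) : R) = 1 := LinearMap.congr_fun hs 1
  exact (mem_maximalIdeal _).mp (h ▸ (f (s 1)).2) isUnit_one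

/-- A nonzero retract of a local ring is the whole ring. -/
lemma comp_eq_id_of_comp_eq_id {N : Type*} [AddCommGroup N] [Module R N] [Nontrivial N]
    {f : N →ₗ[R] R} {r : R →ₗ[R] N} (h : r ∘ₗ f = LinearMap.id) : f ∘ₗ r = LinearMap.id := by
  have hid : ∀ v, r (f v) = v := fun v => LinearMap.congr_fun h v
  have hval : ∀ a : R, f (r a) = a * f (r 1) := fun a => by
    rw [← smul_eq_mul, ← map_smul, ← map_smul, smul_eq_mul, mul_one]
  have he : f (r 1) * (1 - f (r 1)) = 0 := by
    have := hval (f (r 1))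
    rw [hid] at this
    linear_combination this
  refine LinearMap.ext_ring ?_
  change f (r 1) = 1
  rcases isUnit_or_isUnit_one_sub_self (f (r 1)) with hu | hu
  · exact (sub_eq_zero.mp (hu.mul_right_eq_zero.mp he)).symm
  · have h0 := hu.mul_left_eq_zero.mp he
    obtain ⟨v, hv⟩ := exists_ne (0 : N)
    refine absurd ?_ hv
    rw [← hid v, ← hid (r (f v)), hval, h0, mul_zero, map_zero]

lemma smul_dual_maximalIdeal (φ : maximalIdeal R →ₗ[R] R) (y : maximalIdeal R) :
    (y : R) • φ = φ y • (maximalIdeal R).subtype := by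
  ext w
  have h : (y : R) • w = (w : R) • y := Subtype.ext (mul_comm _ _)
  have hφ := congrArg φ h
  rw [map_smul, map_smul] at hφ
  rw [LinearMap.smul_apply, LinearMap.smul_apply, hφ]
  exact mul_comm _ _

lemma isSMulRegular_maximalIdeal {x : R} (hx : IsSMulRegular R x) :
    IsSMulRegular (maximalIdeal R) x :=
  fun _ _ h => Subtype.ext (hx (congrArg Subtype.val h))

variable [IsNoetherianRing R]

lemma isMCM_maximalIdeal (hdim : ringKrullDim R = 1) {x : R} (hxm : x ∈ maximalIdeal R)
    (hx : IsSMulRegular R x) : IsMCM R (maximalIdeal R) := by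
  have : Nontrivial (maximalIdeal R) := by
    refine ⟨⟨x, hxm⟩, 0, fun h => ?_⟩
    have h0 : x = 0 := congrArg Subtype.val h
    exact one_ne_zero (hx (a₁ := 1) (a₂ := 0) (by simp [h0]))
  exact isMCM_of_isSMulRegular hdim hxm (isSMulRegular_maximalIdeal hx)

lemma isMCM_dual_maximalIdeal (hdim : ringKrullDim R = 1) {x : R} (hxm : x ∈ maximalIdeal R)
    (hx : IsSMulRegular R x) : IsMCM R (maximalIdeal R →ₗ[R] R) := by
  have : Module.Finite R (maximalIdeal R →ₗ[R] R) := by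
    obtain ⟨n, p, hp⟩ := Module.Finite.exists_fin' R (maximalIdeal R)
    exact Module.Finite.of_injective (LinearMap.lcomp R R p) fun a b hab =>
      (LinearMap.cancel_right hp).mp hab
  have : Nontrivial (maximalIdeal R →ₗ[R] R) := by
    refine ⟨(maximalIdeal R).subtype, 0, fun h => ?_⟩
    have h0 : x = 0 := LinearMap.congr_fun h ⟨x, hxm⟩
    exact one_ne_zero (hx (a₁ := 1) (a₂ := 0) (by simp [h0]))
  exact isMCM_of_isSMulRegular hdim hxm fun φ ψ h =>
    LinearMap.ext fun y => hx (LinearMap.congr_fun h y)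

lemma not_split_dual_maximalIdeal (hdim : ringKrullDim R = 1) {x : R} (hxm : x ∈ maximalIdeal R)
    (hx : IsSMulRegular R x) :
    ¬ ∃ q : (maximalIdeal R →ₗ[R] R) →ₗ[R] R, q (maximalIdeal R).subtype = 1 := by
  rintro ⟨q, hq⟩
  obtain ⟨n, hn⟩ := exists_maximalIdeal_pow_le_span_singleton hdim hxm hx
  obtain ⟨t, ht, hts⟩ := exists_mul_socle hn (r := 1) fun h =>
    (mem_maximalIdeal x).mp hxm (isUnit_of_dvd_one h)
  rw [mul_one] at ht hts
  obtain ⟨φ, hφ⟩ := exists_linearMap_smul_eq hx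
    (LinearMap.toSpanSingleton R R t ∘ₗ (maximalIdeal R).subtype) (fun y => by
      obtain ⟨c, hc⟩ := hts y y.2
      exact ⟨c, by simpa using hc.symm⟩)
  have h1 : φ ⟨x, hxm⟩ = t := hx (by simpa using hφ ⟨x, hxm⟩)
  have h2 := congrArg q (smul_dual_maximalIdeal φ ⟨x, hxm⟩)
  rw [map_smul, map_smul, hq, h1, smul_eq_mul, smul_eq_mul, mul_one] at h2
  exact ht ⟨_, h2.symm⟩

end AlmostSplit
/-- Let `R` be a one-dimensional Cohen-Macaulay complete Noetherian local ring with maximal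
ideal `m` and `M` an indecomposable finitely generated maximal Cohen-Macaulay `R`-module.
Then there is an irreducible morphism `M → R` iff `M` is isomorphic to a direct summand of
`m` (expressed: the identity of `M` factors through `m`), and if `R` is moreover Gorenstein,
there is an irreducible morphism `R → M` iff `M` is isomorphic to a direct summand of
`Hom_R(m, R)`. -/
theorem irreducible_to_R_iff_summand_of_maximalIdeal
    (R : Type u) [CommRing R] [IsNoetherianRing R] [IsLocalRing R]
    [IsAdicComplete (IsLocalRing.maximalIdeal R) R]
    [HasExt.{u} (ModuleCat.{u} R)]
    (hdim : ringKrullDim R = 1)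
    (hCM : (moduleDepth R R : WithBot ℕ∞) = ringKrullDim R)
    (M : Type u) [AddCommGroup M] [Module R M]
    (hMCM : IsMCM R M) (hind : IsIndecomposableModule R M) :
    ((∃ f : M →ₗ[R] R, IsIrreducibleHom R f) ↔
      ∃ (a : M →ₗ[R] (IsLocalRing.maximalIdeal R))
        (b : (IsLocalRing.maximalIdeal R) →ₗ[R] M), b ∘ₗ a = LinearMap.id) ∧
    (IsGorensteinOneDim R →
      ((∃ f : R →ₗ[R] M, IsIrreducibleHom R f) ↔
        ∃ (a : M →ₗ[R] ((IsLocalRing.maximalIdeal R) →ₗ[R] R))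
          (b : ((IsLocalRing.maximalIdeal R) →ₗ[R] R) →ₗ[R] M), b ∘ₗ a = LinearMap.id)) := by
  obtain ⟨x, hxm, hx⟩ := IsMCM.exists_isSMulRegular hdim hCM
  have hxM : IsSMulRegular M x := IsMCM.isSMulRegular hdim hMCM hxm hx
  have : Module.Finite R M := hMCM.1
  have : Nontrivial M := hind.1
  refine ⟨⟨?_, ?_⟩, fun hG => ?_⟩
  · rintro ⟨f, -, hse, hf⟩
    obtain ⟨f', rfl⟩ := exists_subtype_comp_eq_of_not_split f hse
    rcases hf _ _ _ (isMCM_maximalIdeal hdim hxm hx) f' _ rfl with ⟨r, hr⟩ | ⟨s, hs⟩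
    · exact ⟨f', r, hr⟩
    · exact absurd ⟨s, hs⟩ (not_split_subtype_comp LinearMap.id)
  · rintro ⟨a, b, hba⟩
    refine ⟨(IsLocalRing.maximalIdeal R).subtype ∘ₗ a, ?_, not_split_subtype_comp a, ?_⟩
    · rintro ⟨r, hr⟩
      exact not_split_subtype_comp a ⟨r, comp_eq_id_of_comp_eq_id hr⟩
    · intro L _ _ _ h g hgh
      refine or_iff_not_imp_right.mpr fun hg => ?_
      obtain ⟨g', rfl⟩ := exists_subtype_comp_eq_of_not_split g hg
      have hga : g' ∘ₗ h = a :=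
        LinearMap.ext fun v => Subtype.ext (LinearMap.congr_fun hgh v).symm
      exact ⟨b ∘ₗ g', by rw [LinearMap.comp_assoc, hga, hba]⟩
  have hsoc := hG.socle_cyclic hxm hx
  let j : R →ₗ[R] (IsLocalRing.maximalIdeal R →ₗ[R] R) :=
    LinearMap.toSpanSingleton R _ (IsLocalRing.maximalIdeal R).subtype
  have hj1 : j 1 = (IsLocalRing.maximalIdeal R).subtype := one_smul R _
  have hj : ¬ ∃ q : (IsLocalRing.maximalIdeal R →ₗ[R] R) →ₗ[R] R, q ∘ₗ j = LinearMap.id :=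
    fun ⟨q, hq⟩ => not_split_dual_maximalIdeal hdim hxm hx ⟨q, by
      rw [← hj1]
      exact LinearMap.congr_fun hq 1⟩
  have hext : ∀ (L : Type u) [AddCommGroup L] [Module R L], IsMCM R L → ∀ h : R →ₗ[R] L,
      (¬ ∃ s : L →ₗ[R] R, s ∘ₗ h = LinearMap.id) →
      ∃ h' : (IsLocalRing.maximalIdeal R →ₗ[R] R) →ₗ[R] L, h = h' ∘ₗ j := by
    intro L _ _ hL h hns
    have : Module.Finite R L := hL.1
    obtain ⟨h', hh'⟩ := exists_extension_dual_maximalIdeal hdim hxm hx hsoc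
      (IsMCM.isSMulRegular hdim hL hxm hx) h hns
    refine ⟨h', LinearMap.ext_ring ?_⟩
    rw [LinearMap.comp_apply, hj1, hh']
  constructor
  · rintro ⟨f, hsm, -, hf⟩
    obtain ⟨h', rfl⟩ := hext M hMCM f hsm
    rcases hf _ _ _ (isMCM_dual_maximalIdeal hdim hxm hx) j h' rfl with hr | ⟨s, hs⟩
    · exact absurd hr hj
    · exact ⟨s, h', hs⟩
  · rintro ⟨a, b, hba⟩
    have hsm : ¬ ∃ r : M →ₗ[R] R, r ∘ₗ b ∘ₗ j = LinearMap.id :=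
      fun ⟨r, hr⟩ => hj ⟨r ∘ₗ b, hr⟩
    refine ⟨b ∘ₗ j, hsm, ?_, ?_⟩
    · rintro ⟨s, hs⟩
      exact hsm ⟨s, comp_eq_id_of_comp_eq_id hs⟩
    · intro L _ _ hL h g hgh
      refine or_iff_not_imp_left.mpr fun hh => ?_
      obtain ⟨h', rfl⟩ := hext L hL h hh
      have hgb : g ∘ₗ h' = b := by
        refine LinearMap.ext fun φ => hxM ?_
        have h1 : g (h' (j 1)) = b (j 1) := (LinearMap.congr_fun hgh 1).symm
        have h2 := smul_dual_maximalIdeal φ ⟨x, hxm⟩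
        change x • φ = _ at h2
        change x • g (h' φ) = x • b φ
        rw [← map_smul, ← map_smul, ← map_smul, h2, ← hj1]
        simp only [map_smul, h1]
      exact ⟨h' ∘ₗ a, by rw [← LinearMap.comp_assoc, hgb, hba]⟩
end

section
/- Let k be a field, let p and q be relatively prime integers with p ≥ 3 and q ≥ 3, and let b ∈ k be nonzero. Then the polynomial b·x^p + y^q is irreducible in the polynomial ring k[x, y]; equivalently, the quotient ring k[x, y]/(b·x^p + y^q) is an integral domain. -/
open MvPolynomial

namespace Polynomial

/-- The binomial `y ^ q + b * x ^ p` with coprime exponents is irreducible in `k[x][y]`. -/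
theorem irreducible_X_pow_add_C_C_mul_X_pow {k : Type*} [Field k] {p q : ℕ}
    (hpq : p.Coprime q) (hq : q ≠ 0) {b : k} (hb : b ≠ 0) :
    Irreducible (X ^ q + C (C b * X ^ p) : k[X][X]) := by
  have hmonic : (X ^ q + C (C b * X ^ p) : k[X][X]).Monic := monic_X_pow_add_C _ hq
  have hdeg : (X ^ q + C (C b * X ^ p) : k[X][X]).natDegree = q := natDegree_X_pow_add_C
  refine hmonic.irreducible_iff_natDegree.2 ⟨fun h => hq ?_, fun g h hg hh hgh => ?_⟩
  · rw [← hdeg, h, natDegree_one]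
  let φ : k[X][X] →+* k[X][X] :=
    (compRingHom (C (X ^ p) * X)).comp (mapRingHom (expand k q : k[X] →+* k[X]))
  have coeff_φ (f : k[X][X]) (n : ℕ) :
      (φ f).coeff n = expand k q (f.coeff n) * X ^ (p * n) := by
    simp only [φ, RingHom.comp_apply, coe_mapRingHom, coe_compRingHom_apply, comp_C_mul_X_coeff,
      coeff_map, pow_mul, RingHom.coe_coe]
  have hφ : φ g * φ h = (X ^ q + C (C b)) * (C X) ^ (p * q) := by
    rw [← map_mul, hgh]
    simp [φ]
    ring
  obtain ⟨i, j, u, v, -, huv, hu, -⟩ := mul_eq_mul_prime_pow (prime_C_iff.2 prime_X) hφ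
  rw [← C_pow] at hu
  have hcoeff (n : ℕ) : expand k q (g.coeff n) * X ^ (p * n) = u.coeff n * X ^ i := by
    rw [← coeff_φ, hu, coeff_mul_C]
  have natDegree_coeff {n : ℕ} (hn : IsUnit (u.coeff n)) :
      (g.coeff n).natDegree * q + p * n = i := by
    have h0 : expand k q (g.coeff n) ≠ 0 := fun h0 => by
      have := hcoeff n
      rw [h0, zero_mul] at this
      exact mul_ne_zero hn.ne_zero (pow_ne_zero _ X_ne_zero) this.symm
    have := congrArg natDegree (hcoeff n)
    rwa [natDegree_mul h0 (pow_ne_zero _ X_ne_zero),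
      natDegree_mul hn.ne_zero (pow_ne_zero _ X_ne_zero), natDegree_expand, natDegree_X_pow,
      natDegree_X_pow, natDegree_eq_zero_of_isUnit hn, zero_add] at this
  have hzero := natDegree_coeff (n := 0) <| isUnit_of_mul_isUnit_left (y := v.coeff 0) <| by
    rw [← mul_coeff_zero, ← huv]
    simp [hb, hq.symm]
  have hudeg : u.natDegree = g.natDegree := by
    have hXi : (C (X ^ i) : k[X][X]) ≠ 0 := C_ne_zero.2 (pow_ne_zero _ X_ne_zero)
    have hu0 : u ≠ 0 := left_ne_zero_of_mul (huv ▸ (monic_X_pow_add_C _ hq).ne_zero)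
    have hφdeg : (φ g).natDegree = g.natDegree := by
      simp only [φ, RingHom.comp_apply, coe_mapRingHom, coe_compRingHom_apply]
      rw [natDegree_comp, natDegree_C_mul_X _ (pow_ne_zero _ X_ne_zero), mul_one,
        hg.natDegree_map]
    rw [← hφdeg, hu, natDegree_mul hu0 hXi, natDegree_C, add_zero]
  have hlead := natDegree_coeff (n := g.natDegree) <| by
    rw [← hudeg, coeff_natDegree]
    refine isUnit_of_mul_isUnit_left (y := v.leadingCoeff) ?_
    rw [← leadingCoeff_mul, ← huv, (monic_X_pow_add_C _ hq).leadingCoeff]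
    exact isUnit_one
  rw [hg.coeff_natDegree, natDegree_one] at hlead
  have hdvd : q ∣ g.natDegree := by
    refine hpq.symm.dvd_of_dvd_mul_left ⟨(g.coeff 0).natDegree, ?_⟩
    linarith
  have hadd : g.natDegree + h.natDegree = q := by
    rw [← hg.natDegree_mul hh, hgh, hdeg]
  obtain ⟨c, hc⟩ := hdvd
  rcases c with _ | c
  · left; simpa using hc
  · right; nlinarith

end Polynomial

/-- Let `k` be a field, `p` and `q` relatively prime integers `≥ 3` and `b ∈ k` nonzero.
Then `b·x^p + y^q` is irreducible in `k[x, y]`; equivalently, `k[x,y]/(b·x^p + y^q)` is an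
integral domain. -/
theorem bxp_add_yq_irreducible
    (k : Type*) [Field k] (p q : ℕ) (hpq : Nat.Coprime p q) (hp : 3 ≤ p) (hq : 3 ≤ q)
    (b : k) (hb : b ≠ 0) :
    Irreducible (C b * X 0 ^ p + X 1 ^ q : MvPolynomial (Fin 2) k) ∧
    IsDomain (MvPolynomial (Fin 2) k ⧸
      Ideal.span {(C b * X 0 ^ p + X 1 ^ q : MvPolynomial (Fin 2) k)}) := by
  have hirr : Irreducible (C b * X 0 ^ p + X 1 ^ q : MvPolynomial (Fin 2) k) := by
    let e : MvPolynomial (Fin 2) k ≃ₐ[k] Polynomial (Polynomial k) :=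
      (finSuccEquiv k 1).trans (Polynomial.mapAlgEquiv (uniqueAlgEquiv k (Fin 1)))
    have hX : e (X 0) = Polynomial.X := by simp [e, finSuccEquiv_X_zero]
    have hY : e (X 1) = Polynomial.C Polynomial.X := by
      have := finSuccEquiv_X_succ (R := k) (n := 1) (j := 0)
      rw [Fin.succ_zero_eq_one] at this
      simp [e, this]
    have hunit : IsUnit (C b : MvPolynomial (Fin 2) k) := hb.isUnit.map C
    have hfactor : (C b * X 0 ^ p + X 1 ^ q : MvPolynomial (Fin 2) k) =
        C b * (X 0 ^ p + C b⁻¹ * X 1 ^ q) := by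
      rw [mul_add, ← mul_assoc, ← C_mul, mul_inv_cancel₀ hb, C_1, one_mul]
    rw [hfactor, irreducible_isUnit_mul hunit, ← MulEquiv.irreducible_iff e]
    convert Polynomial.irreducible_X_pow_add_C_C_mul_X_pow hpq.symm (by omega : p ≠ 0)
      (inv_ne_zero hb) using 1
    rw [← algebraMap_eq]
    simp only [map_add, map_mul, map_pow, hX, hY, AlgEquiv.commutes]
    rfl
  have := (Ideal.span_singleton_prime hirr.ne_zero).2 hirr.prime
  exact ⟨hirr, inferInstance⟩
end

section
/- Let R be a one-dimensional Gorenstein complete Noetherian local domain which is not regular and whose residue field is algebraically closed, with quotient field Q = Q(R). Let M be an indecomposable finitely generated torsion-free R-module which is not free (torsion-free is equivalent here to maximal Cohen-Macaulay). Let f ∈ End_R(M) be an endomorphism such that for every h ∈ End_R(M) which is not an automorphism, the composite h ∘ f factors through a finitely generated free R-module (i.e., the class of f lies in the socle of the stable endomorphism ring of M). Let 0 → N → F → M → 0 be a short exact sequence of R-modules with F finitely generated free, and let g ∈ End_R(N) and A ∈ End_R(F) be such that A restricts to g on N and induces f on M. Then trace(f ⊗_R Q) + trace(g ⊗_R Q)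 lies in the image of R in Q. -/
open CategoryTheory CategoryTheory.Abelian

universe u

/-- A Noetherian local ring is regular if its maximal ideal can be generated by
`dim R` many elements. -/
def IsRegularLocal (R : Type*) [CommRing R] [IsLocalRing R] : Prop :=
  ∃ s : Finset R, Ideal.span (s : Set R) = IsLocalRing.maximalIdeal R ∧
    (s.card : WithBot ℕ∞) = ringKrullDim R

/-- The trace is additive along short exact sequences of finite free modules: if `A`
restricts to `g` and induces `f`, then `trace A = trace f + trace g`. -/
theorem LinearMap.trace_eq_add_of_exact {K N F M : Type*} [CommRing K]
    [AddCommGroup N] [Module K N] [Module.Free K N] [Module.Finite K N]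
    [AddCommGroup F] [Module K F] [Module.Free K F] [Module.Finite K F]
    [AddCommGroup M] [Module K M] [Module.Free K M] [Module.Finite K M]
    {i : N →ₗ[K] F} {p : F →ₗ[K] M} (hi : Function.Injective i)
    (hp : Function.Surjective p) (hex : Function.Exact i p)
    {g : N →ₗ[K] N} {A : F →ₗ[K] F} {f : M →ₗ[K] M}
    (hg : A ∘ₗ i = i ∘ₗ g) (hf : p ∘ₗ A = f ∘ₗ p) :
    LinearMap.trace K F A = LinearMap.trace K M f + LinearMap.trace K N g := by
  obtain ⟨t, ht⟩ := Module.projective_lifting_property p LinearMap.id hp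
  obtain ⟨e, rfl, rfl⟩ := (hex.splitSurjectiveEquiv hi) ⟨t, ht⟩
  have hsum : A = (A ∘ₗ e.symm ∘ₗ .inl K N M) ∘ₗ .fst K N M ∘ₗ e +
      (A ∘ₗ e.symm ∘ₗ .inr K N M) ∘ₗ .snd K N M ∘ₗ e := by
    ext x
    simp [← map_add]
  have hfst : (.fst K N M ∘ₗ e.toLinearMap) ∘ₗ e.symm.toLinearMap ∘ₗ .inl K N M ∘ₗ g = g := by
    ext x
    simp
  have hsnd : (f ∘ₗ .snd K N M ∘ₗ e.toLinearMap) ∘ₗ e.symm.toLinearMap ∘ₗ .inr K N M = f := by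
    ext x
    simp
  have hN : LinearMap.trace K F ((A ∘ₗ e.symm ∘ₗ .inl K N M) ∘ₗ .fst K N M ∘ₗ e) =
      LinearMap.trace K N g := by
    rw [hg, LinearMap.trace_comp_comm']
    exact congr_arg _ hfst
  have hM : LinearMap.trace K F ((A ∘ₗ e.symm ∘ₗ .inr K N M) ∘ₗ .snd K N M ∘ₗ e) =
      LinearMap.trace K M f := by
    rw [LinearMap.trace_comp_comm', ← LinearMap.comp_assoc, hf]
    exact congr_arg _ hsnd
  rw [hsum, map_add, hN, hM, add_comm]

open TensorProduct in
/-- Let `R` be a one-dimensional Gorenstein complete Noetherian local domain, not regular,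
with algebraically closed residue field, and quotient field `Q`.  Let `M` be an
indecomposable finitely generated torsion-free non-free `R`-module, and `f ∈ End_R(M)` such
that `h ∘ f` factors through a finitely generated free module for every non-automorphism
`h` (i.e. the class of `f` lies in the socle of the stable endomorphism ring).  Given a
short exact sequence `0 → N → F → M → 0` with `F` finitely generated free, and `g ∈
End_R(N)`, `A ∈ End_R(F)` such that `A` restricts to `g` on `N` and induces `f` on `M`,
the sum `trace(f ⊗ Q) + trace(g ⊗ Q)` lies in the image of `R` in `Q`. -/
theorem trace_sum_mem_of_socle
    (R : Type u) [CommRing R] [IsDomain R] [IsNoetherianRing R] [IsLocalRing R]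
    [IsAdicComplete (IsLocalRing.maximalIdeal R) R]
    [HasExt.{u} (ModuleCat.{u} R)]
    (hdim : ringKrullDim R = 1) (hGor : IsGorensteinOneDim R)
    (hnotreg : ¬ IsRegularLocal R)
    [IsAlgClosed (IsLocalRing.ResidueField R)]
    (Q : Type*) [Field Q] [Algebra R Q] [IsFractionRing R Q]
    (M : Type u) [AddCommGroup M] [Module R M] [Module.Finite R M]
    [NoZeroSMulDivisors R M]
    (hind : IsIndecomposableModule R M) (hnotfree : ¬ Module.Free R M)
    (f : Module.End R M)
    (hf : ∀ h : Module.End R M, ¬ Function.Bijective h →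
      ∃ (n : ℕ) (a : M →ₗ[R] (Fin n → R)) (b : (Fin n → R) →ₗ[R] M),
        ((h ∘ₗ f : Module.End R M) : M →ₗ[R] M) = b ∘ₗ a)
    (N F : Type u) [AddCommGroup N] [Module R N]
    [AddCommGroup F] [Module R F] [Module.Finite R F] [Module.Free R F]
    (ι : N →ₗ[R] F) (pr : F →ₗ[R] M)
    (hι : Function.Injective ι) (hpr : Function.Surjective pr)
    (hex : LinearMap.range ι = LinearMap.ker pr)
    (g : Module.End R N) (A : Module.End R F)
    (hAg : A ∘ₗ ι = ι ∘ₗ g) (hAf : pr ∘ₗ A = (f : M →ₗ[R] M) ∘ₗ pr) :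
    LinearMap.trace Q (Q ⊗[R] M) (LinearMap.baseChange Q (f : M →ₗ[R] M)) +
      LinearMap.trace Q (Q ⊗[R] N) (LinearMap.baseChange Q (g : N →ₗ[R] N)) ∈
        (algebraMap R Q).range := by
  have := Module.Finite.of_injective ι hι
  have := IsLocalization.flat Q (nonZeroDivisors R)
  have htrace := LinearMap.trace_eq_add_of_exact
    (i := ι.baseChange Q) (p := pr.baseChange Q) (g := g.baseChange Q) (A := A.baseChange Q)
    (f := f.baseChange Q)
    (Module.Flat.lTensor_preserves_injective_linearMap ι hι)
    (LinearMap.lTensor_surjective Q hpr)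
    (lTensor_exact Q (LinearMap.exact_iff.mpr hex.symm) hpr)
    (by rw [← LinearMap.baseChange_comp, ← LinearMap.baseChange_comp]; exact congr_arg _ hAg)
    (by rw [← LinearMap.baseChange_comp, ← LinearMap.baseChange_comp]; exact congr_arg _ hAf)
  exact ⟨LinearMap.trace R F A, by rw [← htrace, LinearMap.trace_baseChange]⟩
end
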